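/- arXiv:2206.09366 — 2 statements merged into one kernel-verified Lean document; each statement's English description precedes it below -/
import Mathlib

section
/- For all K and ε > 0 there exists c such that the following holds. Let A and B be finite non-empty subsets of an abelian group, and let 1 ≤ c₁ ≤ |A| and 1 ≤ c₂ ≤ |B| be integers satisfying c₁c₂ ≥ c·max(|A|, |B|). Then there exist subsets A* ⊆ A and B* ⊆ B with |A*| ≥ (1−ε)|A| and |B*| ≥ (1−ε)|B| such that if points a₁, …, a_{c₁} and b₁, …, b_{c₂} are selected uniformly and independently at random from A* and B* respectively, and A' = {a₁, …, a_{c₁}}, B' = {b₁, …, b_{c₂}}, then E|A' + B'| ≥ min((1−ε)|A* + B*|, K|A*|, K|B*|). -/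
open Finset Pointwise

lemma aux_sum_single {ι α : Type*} [Fintype ι] [DecidableEq ι] [Fintype α] [Nonempty α]
    (i : ι) (φ : α → ℝ) :
    ∑ f : ι → α, φ (f i) =
      (Fintype.card α : ℝ) ^ (Fintype.card ι) * ((∑ a, φ a) / Fintype.card α) := by
  have hpos : (0:ℝ) < Fintype.card α := by exact_mod_cast Fintype.card_pos
  rw [← (Equiv.funSplitAt i α).symm.sum_comp]
  rw [Fintype.sum_prod_type]
  have h1 : ∀ (a : α) (h : {j // j ≠ i} → α), (Equiv.funSplitAt i α).symm (a, h) i = a := by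
    intro a h; simp
  simp only [h1, sum_const, card_univ, Fintype.card_fun, nsmul_eq_mul]
  rw [← mul_sum]
  have h2 : Fintype.card ι = Fintype.card {j // j ≠ i} + 1 := by
    have : 0 < Fintype.card ι := Fintype.card_pos_iff.2 ⟨i⟩
    simp [Fintype.card_subtype_compl]; omega
  rw [h2]
  push_cast
  field_simp
  ring

lemma aux_sum_pair {ι α : Type*} [Fintype ι] [DecidableEq ι] [Fintype α] [Nonempty α]
    (i i' : ι) (h : i ≠ i') (φ : α → α → ℝ) :
    ∑ f : ι → α, φ (f i) (f i') =
      (Fintype.card α : ℝ) ^ (Fintype.card ι) *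
        ((∑ a, ∑ b, φ a b) / (Fintype.card α : ℝ) ^ 2) := by
  have hpos : (0:ℝ) < Fintype.card α := by exact_mod_cast Fintype.card_pos
  rw [← (Equiv.funSplitAt i α).symm.sum_comp]
  rw [Fintype.sum_prod_type]
  have h1 : ∀ (a : α) (g : {j // j ≠ i} → α), (Equiv.funSplitAt i α).symm (a, g) i = a := by
    intro a g; simp
  have h1' : ∀ (a : α) (g : {j // j ≠ i} → α),
      (Equiv.funSplitAt i α).symm (a, g) i' = g ⟨i', h.symm⟩ := by
    intro a g; simp [h.symm]
  simp only [h1, h1']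
  have h2 : Fintype.card ι = Fintype.card {j // j ≠ i} + 1 := by
    have : 0 < Fintype.card ι := Fintype.card_pos_iff.2 ⟨i⟩
    simp [Fintype.card_subtype_compl]; omega
  have h3 : ∀ a : α, ∑ g : {j // j ≠ i} → α, φ a (g ⟨i', h.symm⟩) = _ :=
    fun a => aux_sum_single (ι := {j // j ≠ i}) ⟨i', h.symm⟩ (φ a)
  simp only [h3]
  rw [← mul_sum, ← sum_div, h2]
  field_simp
  ring

lemma aux_sum_sq {α : Type*} [Fintype α] [Nonempty α]
    (k : ℕ) (φ : α → α → ℝ) :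
    ∑ f : Fin k → α, ∑ i, ∑ i', φ (f i) (f i') =
      (Fintype.card α : ℝ) ^ k *
        (k * (∑ a, φ a a) / (Fintype.card α : ℝ) +
          k * (k - 1) * (∑ a, ∑ b, φ a b) / (Fintype.card α : ℝ) ^ 2) := by
  have key : ∀ i i' : Fin k, ∑ f : Fin k → α, φ (f i) (f i') =
      (Fintype.card α : ℝ) ^ k * ((∑ a, ∑ b, φ a b) / (Fintype.card α : ℝ) ^ 2) +
      if i = i' then (Fintype.card α : ℝ) ^ k * ((∑ a, φ a a) / (Fintype.card α : ℝ) -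
        (∑ a, ∑ b, φ a b) / (Fintype.card α : ℝ) ^ 2) else 0 := by
    intro i i'
    split_ifs with h
    · subst h
      have := aux_sum_single i (fun a => φ a a)
      rw [Fintype.card_fin] at this
      rw [this]; ring
    · have := aux_sum_pair i i' h φ
      rw [Fintype.card_fin] at this
      rw [this]; ring
  rw [sum_comm]
  simp_rw [sum_comm (s := (univ : Finset (Fin k → α)))]
  simp only [key, sum_add_distrib, sum_const, card_univ, Fintype.card_fin, nsmul_eq_mul,
    sum_ite_eq, mem_univ, if_true]
  ring

lemma aux_lin {α : Type*} [Fintype α] (P Q : α → α → ℝ) (x y z v w : ℝ) :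
    ∑ a, ∑ a', x * (y * P a a' / v + z * Q a a' / w) =
      x * (y * (∑ a, ∑ a', P a a') / v + z * (∑ a, ∑ a', Q a a') / w) := by
  simp only [mul_sum, sum_div, ← sum_add_distrib]

lemma aux_lin1 {α : Type*} [Fintype α] (P Q : α → ℝ) (x y z v w : ℝ) :
    ∑ a, x * (y * P a / v + z * Q a / w) =
      x * (y * (∑ a, P a) / v + z * (∑ a, Q a) / w) := by
  simp only [mul_sum, sum_div, ← sum_add_distrib]

lemma aux_hit {α β : Type*} [Fintype α] [Nonempty α] [Fintype β] [Nonempty β]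
    (R : α → β → Prop) [∀ a b, Decidable (R a b)]
    (h1 : ∀ a b b', R a b → R a b' → b = b') (h2 : ∀ a a' b, R a b → R a' b → a = a')
    (k l : ℕ) (hk : 1 ≤ k) (hl : 1 ≤ l) (r H : ℝ)
    (hr : r = ∑ a, ∑ b, if R a b then (1:ℝ) else 0) (hr0 : 0 < r)
    (hH : H = ∑ f : Fin k → α, ∑ g : Fin l → β, if ∃ i j, R (f i) (g j) then (1:ℝ) else 0) :
    (Fintype.card α : ℝ) ^ k * (Fintype.card β : ℝ) ^ l ≤
      H * (1 + (Fintype.card α : ℝ) * Fintype.card β / (k * l * r) +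
        (Fintype.card β : ℝ) / (l * r) + (Fintype.card α : ℝ) / (k * r)) := by
  set e : α → β → ℝ := fun a b => if R a b then (1:ℝ) else 0 with he
  set m : ℝ := (Fintype.card α : ℝ) with hm
  set n : ℝ := (Fintype.card β : ℝ) with hn
  have hmpos : (0:ℝ) < m := by rw [hm]; exact_mod_cast Fintype.card_pos
  have hnpos : (0:ℝ) < n := by rw [hn]; exact_mod_cast Fintype.card_pos
  have hk' : (1:ℝ) ≤ k := by exact_mod_cast hk
  have hl' : (1:ℝ) ≤ l := by exact_mod_cast hl
  have hr' : r = ∑ a, ∑ b, e a b := hr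
  let Z : (Fin k → α) × (Fin l → β) → ℝ := fun p => ∑ i, ∑ j, e (p.1 i) (p.2 j)
  let I : (Fin k → α) × (Fin l → β) → ℝ :=
    fun p => if ∃ i j, R (p.1 i) (p.2 j) then (1:ℝ) else 0
  have hZI : ∀ p, I p * Z p = Z p := by
    intro p
    by_cases hp : ∃ i j, R (p.1 i) (p.2 j)
    · simp [I, hp]
    · have : Z p = 0 := by
        push Not at hp
        simp only [Z, he]
        refine sum_eq_zero fun i _ => sum_eq_zero fun j _ => ?_
        simp [hp i j]
      simp [this]
  have hI2 : ∑ p, I p ^ 2 = H := by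
    rw [hH, Fintype.sum_prod_type]
    refine sum_congr rfl fun f _ => sum_congr rfl fun g _ => ?_
    simp only [I]; split_ifs <;> simp
  have cs := sum_mul_sq_le_sq_mul_sq univ I Z
  simp only [hZI, hI2] at cs
  have S1 : ∑ p, Z p = m ^ k * n ^ l * (k * l * r / (m * n)) := by
    rw [Fintype.sum_prod_type]
    simp only [Z]
    have a1 : ∀ f : Fin k → α, ∑ g : Fin l → β, ∑ i, ∑ j, e (f i) (g j)
        = ∑ i, l * (n ^ l * ((∑ b, e (f i) b) / n)) := by
      intro f
      rw [sum_comm]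
      refine sum_congr rfl fun i _ => ?_
      rw [sum_comm]
      have : ∀ j : Fin l, ∑ g : Fin l → β, e (f i) (g j) = _ := fun j => aux_sum_single j (e (f i))
      simp only [this, sum_const, card_univ, Fintype.card_fin, nsmul_eq_mul, hn]
    simp only [a1]
    rw [sum_comm]
    have a2 : ∀ i : Fin k, ∑ f : Fin k → α, (fun a => l * (n ^ l * ((∑ b, e a b) / n))) (f i) = _ :=
      fun i => aux_sum_single i (fun a => l * (n ^ l * ((∑ b, e a b) / n)))
    simp only [] at a2
    simp only [a2, sum_const, card_univ, Fintype.card_fin, nsmul_eq_mul]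
    rw [hr', ← mul_sum, ← mul_sum, ← sum_div, ← hm]
    field_simp
  have hee : ∀ a b, e a b * e a b = e a b := by intro a b; simp [he]
  have hrow : ∀ a, ∑ b, ∑ b', e a b * e a b' = ∑ b, e a b := by
    intro a
    refine sum_congr rfl fun b _ => ?_
    rw [sum_eq_single b]
    · exact hee a b
    · intro b' _ hb
      simp only [he]
      by_cases x1 : R a b <;> by_cases x2 : R a b' <;> simp [x1, x2]
      exact hb (h1 a b' b x2 x1)
    · simp
  have hcol : ∀ b, ∑ a, ∑ a', e a b * e a' b = ∑ a, e a b := by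
    intro b
    refine sum_congr rfl fun a _ => ?_
    rw [sum_eq_single a]
    · exact hee a b
    · intro a' _ ha
      simp only [he]
      by_cases x1 : R a b <;> by_cases x2 : R a' b <;> simp [x1, x2]
      exact ha (h2 a' a b x2 x1)
    · simp
  have S2 : ∑ p, Z p ^ 2 = m ^ k * n ^ l *
      (k * l * r / (m * n) + k * (k-1) * l * r / (m ^ 2 * n) + k * l * (l-1) * r / (m * n ^ 2)
        + k * (k-1) * (l * (l-1)) * r ^ 2 / (m ^ 2 * n ^ 2)) := by
    rw [Fintype.sum_prod_type]
    have b1 : ∀ (f : Fin k → α), ∑ g : Fin l → β, Z (f, g) ^ 2 = 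
        ∑ i, ∑ i', n ^ l * (l * (∑ b, e (f i) b * e (f i') b) / n + 
          l * (l-1) * (∑ b, ∑ b', e (f i) b * e (f i') b') / n ^ 2) := by
      intro f
      have : ∀ g : Fin l → β, Z (f, g) ^ 2 = ∑ i, ∑ i', ∑ j, ∑ j', e (f i) (g j) * e (f i') (g j') := by
        intro g
        simp only [Z, sq, sum_mul_sum]
      simp only [this]
      rw [sum_comm]
      refine sum_congr rfl fun i _ => ?_
      rw [sum_comm]
      refine sum_congr rfl fun i' _ => ?_
      exact aux_sum_sq l (fun b b' => e (f i) b * e (f i') b')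
    simp only [b1]
    rw [aux_sum_sq k (fun a a' => n ^ l * (l * (∑ b, e a b * e a' b) / n + 
          l * (l-1) * (∑ b, ∑ b', e a b * e a' b') / n ^ 2))]
    simp only [hee, hrow]
    have c1 : ∑ a, ∑ a', ∑ b, e a b * e a' b = r := by
      simp_rw [sum_comm (s := (univ : Finset α)) (t := (univ : Finset β))]
      simp_rw [hcol]
      rw [hr', sum_comm]
    have c2 : ∑ a, ∑ a', ∑ b, ∑ b', e a b * e a' b' = r ^ 2 := by
      simp_rw [← sum_mul_sum]
      rw [hr', sq]
    rw [aux_lin, aux_lin1, c1, c2, ← hr', ← hm]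
    field_simp
    ring
  set u : ℝ := k * l * r / (m * n) with hu
  have hu0 : 0 < u := by positivity
  set N : ℝ := m ^ k * n ^ l with hN
  have hN0 : 0 < N := by positivity
  have hH0 : 0 ≤ H := by rw [← hI2]; positivity
  have S2' : ∑ p, Z p ^ 2 ≤ N * (u * (1 + k / m + l / n + u)) := by
    rw [S2]
    gcongr
    have e1 : k * (k-1) * l * r / (m ^ 2 * n) ≤ u * (k / m) := by
      rw [hu, div_mul_div_comm, div_le_div_iff₀ (by positivity) (by positivity)]
      have : (0:ℝ) ≤ k * l * r * (m^2 * n) := by positivity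
      nlinarith
    have e2 : k * l * (l-1) * r / (m * n^2) ≤ u * (l / n) := by
      rw [hu, div_mul_div_comm, div_le_div_iff₀ (by positivity) (by positivity)]
      have : (0:ℝ) ≤ k * l * r * (m * n^2) := by positivity
      nlinarith
    have e3 : k * (k-1) * (l * (l-1)) * r ^ 2 / (m ^ 2 * n ^ 2) ≤ u * u := by
      rw [hu, div_mul_div_comm, show m * n * (m * n) = m^2 * n^2 by ring]
      refine div_le_div_of_nonneg_right ?_ (by positivity)
      have : (k:ℝ) * l * r * (k * l * r) = k * k * (l * l) * r ^ 2 := by ring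
      rw [this]
      have i1 : (k:ℝ) - 1 ≤ k := by linarith
      have i2 : (l:ℝ) - 1 ≤ l := by linarith
      have i3 : (0:ℝ) ≤ (l:ℝ) - 1 := by linarith
      gcongr
    linarith
  rw [S1] at cs
  have cs2 : (N * u) * (N * u) ≤ (N * u) * (H * (1 + k / m + l / n + u)) := by
    calc (N * u) * (N * u) = (N * u) ^ 2 := by ring
      _ ≤ H * ∑ p, Z p ^ 2 := cs
      _ ≤ H * (N * (u * (1 + k / m + l / n + u))) := by gcongr
      _ = _ := by ring
  have cs3 := le_of_mul_le_mul_left cs2 (by positivity)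
  have : N ≤ H * (1 + k / m + l / n + u) / u := by
    rw [le_div_iff₀ hu0]; exact cs3
  refine this.trans_eq ?_
  rw [hu]
  have : (0:ℝ) < k := by linarith
  have : (0:ℝ) < l := by linarith
  field_simp
  ring

def repCount {G : Type*} [AddCommGroup G] [DecidableEq G] (A B : Finset G) (x : G) : ℕ :=
  #{p ∈ A ×ˢ B | p.1 + p.2 = x}

lemma repCount_pos {G : Type*} [AddCommGroup G] [DecidableEq G] {A B : Finset G} {x : G}
    (hx : x ∈ A + B) : 0 < repCount A B x := by
  obtain ⟨a, ha, b, hb, rfl⟩ := mem_add.1 hx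
  exact card_pos.2 ⟨(a, b), by simp [ha, hb]⟩

lemma aux_frac (m n k l c r m' n' : ℝ) (hr : 0 < r) (hc : 0 < c) (hk : 0 < k) (hl : 0 < l)
    (hm' : 0 < m') (hn' : 0 < n')
    (hm : m' ≤ m) (hn : n' ≤ n) (hkm : k ≤ m) (hln : l ≤ n) (h : c * max m n ≤ k * l) :
    (1 + m' * n' / (k * l * r) + n' / (l * r) + m' / (k * r)) ≤
      (c * r + 3 * min m n) / (c * r) := by
  have hmm : max m n * min m n = m * n := max_mul_min m n
  have hm0 : 0 < m := by linarith
  have hn0 : 0 < n := by linarith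
  have hmin : 0 < min m n := lt_min hm0 hn0
  have key : m * n * c ≤ k * l * min m n := by
    rw [← hmm]; nlinarith
  have e1 : m' * n' / (k * l * r) ≤ min m n / (c * r) := by
    rw [div_le_div_iff₀ (by positivity) (by positivity)]
    have : m' * n' ≤ m * n := by gcongr
    nlinarith [mul_le_mul_of_nonneg_right this hc.le]
  have e2 : n' / (l * r) ≤ min m n / (c * r) := by
    rw [div_le_div_iff₀ (by positivity) (by positivity)]
    have h1 : n' * c ≤ min m n * l := by
      have : k * (n' * c) ≤ k * (min m n * l) := by
        calc k * (n' * c) ≤ m * (n * c) := by gcongr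
          _ ≤ _ := by linarith
      exact le_of_mul_le_mul_left this hk
    nlinarith
  have e3 : m' / (k * r) ≤ min m n / (c * r) := by
    rw [div_le_div_iff₀ (by positivity) (by positivity)]
    have h1 : m' * c ≤ min m n * k := by
      have : l * (m' * c) ≤ l * (min m n * k) := by
        calc l * (m' * c) ≤ n * (m * c) := by gcongr
          _ ≤ _ := by linarith
      exact le_of_mul_le_mul_left this hl
    nlinarith
  have : (c * r + 3 * min m n) / (c * r) = 1 + 3 * (min m n / (c * r)) := by
    field_simp
  rw [this]; linarith

lemma aux_expect {G : Type*} [AddCommGroup G] [DecidableEq G] (A B : Finset G)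
    (hA : A.Nonempty) (hB : B.Nonempty) (m n : ℝ) (hAm : (A.card : ℝ) ≤ m) (hBn : (B.card : ℝ) ≤ n)
    (k l : ℕ) (hk : 1 ≤ k) (hl : 1 ≤ l) (hkm : (k:ℝ) ≤ m) (hln : (l:ℝ) ≤ n) (c : ℝ) (hc : 0 < c)
    (h : c * max m n ≤ k * l) :
    ∑ x ∈ A + B, c * repCount A B x / (c * repCount A B x + 3 * min m n) ≤
    (∑ f : Fin k → ↥A, ∑ g : Fin l → ↥B,
                  ((Finset.image (fun i => (f i : G)) Finset.univ +
                    Finset.image (fun j => (g j : G)) Finset.univ).card : ℝ)) /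
                ((A.card : ℝ) ^ k * (B.card : ℝ) ^ l) := by
  have : Nonempty ↥A := hA.to_subtype
  have : Nonempty ↥B := hB.to_subtype
  have hA0 : (0:ℝ) < A.card := by exact_mod_cast hA.card_pos
  have hB0 : (0:ℝ) < B.card := by exact_mod_cast hB.card_pos
  have hmin : 0 < min m n := lt_min (by linarith) (by linarith)
  rw [le_div_iff₀ (by positivity), sum_mul]
  have hcard : ∀ (f : Fin k → ↥A) (g : Fin l → ↥B), 
      ((Finset.image (fun i => (f i : G)) Finset.univ +
        Finset.image (fun j => (g j : G)) Finset.univ).card : ℝ) =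
      ∑ x ∈ A + B, if ∃ i j, (f i : G) + (g j : G) = x then (1:ℝ) else 0 := by
    intro f g
    rw [sum_boole]
    congr 2
    ext x
    simp only [mem_add, mem_image, mem_univ, true_and, mem_filter]
    constructor
    · rintro ⟨_, ⟨i, rfl⟩, _, ⟨j, rfl⟩, rfl⟩
      exact ⟨⟨_, (f i).2, _, (g j).2, rfl⟩, i, j, rfl⟩
    · rintro ⟨_, i, j, rfl⟩
      exact ⟨_, ⟨i, rfl⟩, _, ⟨j, rfl⟩, rfl⟩
  simp only [hcard]
  have hswap : (∑ f : Fin k → ↥A, ∑ g : Fin l → ↥B, 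
      ∑ x ∈ A + B, if ∃ i j, (f i : G) + (g j : G) = x then (1:ℝ) else 0) = 
      ∑ x ∈ A + B, ∑ f : Fin k → ↥A, ∑ g : Fin l → ↥B, 
        if ∃ i j, (f i : G) + (g j : G) = x then (1:ℝ) else 0 := by
    exact (sum_congr rfl fun f _ => sum_comm).trans sum_comm
  rw [hswap]
  refine sum_le_sum fun x hx => ?_
  have hr0 : (0:ℝ) < repCount A B x := by exact_mod_cast repCount_pos hx
  have hr : (repCount A B x : ℝ) =
      ∑ a : ↥A, ∑ b : ↥B, if (a : G) + (b : G) = x then (1:ℝ) else 0 := by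
    rw [repCount, ← sum_boole, sum_product, ← sum_coe_sort A]
    refine sum_congr rfl fun a _ => ?_
    rw [← sum_coe_sort B]
  have hit := aux_hit (α := ↥A) (β := ↥B) (fun a b => (a : G) + (b : G) = x)
    (fun a b b' h1 h2 => Subtype.ext (add_left_cancel (h1.trans h2.symm)))
    (fun a a' b h1 h2 => Subtype.ext (add_right_cancel (h1.trans h2.symm)))
    k l hk hl (repCount A B x) _ hr hr0 rfl
  rw [Fintype.card_coe, Fintype.card_coe] at hit
  set H := ∑ f : Fin k → ↥A, ∑ g : Fin l → ↥B, 
        if ∃ i j, (f i : G) + (g j : G) = x then (1:ℝ) else 0 with hH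
  have hH0 : 0 ≤ H := by rw [hH]; positivity
  have hfr := aux_frac m n k l c (repCount A B x) A.card B.card hr0 hc
    (by exact_mod_cast hk) (by exact_mod_cast hl) hA0 hB0 hAm hBn hkm hln h
  have h3 := hit.trans (mul_le_mul_of_nonneg_left hfr hH0)
  rw [mul_div_assoc', le_div_iff₀ (by positivity)] at h3
  rw [div_mul_eq_mul_div, div_le_iff₀ (by positivity)]
  linarith

lemma aux_plun {G : Type*} [AddCommGroup G] [DecidableEq G] (A B : Finset G)
    (L q : ℝ) (hq : 0 < q) (hA : q / 2 ≤ A.card) (hB : q / 2 ≤ B.card)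
    (hAB : ((A + B).card : ℝ) ≤ L * q) : ((-A + A + B).card : ℝ) ≤ 16 * L ^ 5 * q := by
  have hA0 : (0:ℝ) < A.card := by linarith
  have hB0 : (0:ℝ) < B.card := by linarith
  have hAne : A.Nonempty := card_pos.1 (by exact_mod_cast hA0)
  have hBne : B.Nonempty := card_pos.1 (by exact_mod_cast hB0)
  have hBL : (B.card : ℝ) ≤ L * q := le_trans (by exact_mod_cast card_le_card_add_left hAne) hAB
  have hL : 0 < L := by
    by_contra hcon
    push Not at hcon
    nlinarith
  have p1 := pluennecke_ruzsa_inequality_nsmul_sub_nsmul_add hBne A 2 1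
  have p1' : ((2 • A - 1 • A).card : ℝ) ≤ ((B + A).card / B.card : ℝ) ^ 3 * B.card := by
    have := (NNRat.cast_le (K := ℝ)).2 p1
    push_cast at this
    exact this
  have ratio : ((B + A).card / B.card : ℝ) ≤ 2 * L := by
    rw [div_le_iff₀ hB0, add_comm]
    nlinarith
  have p2 : ((2 • A - 1 • A).card : ℝ) ≤ (2 * L) ^ 3 * (L * q) := by
    refine p1'.trans ?_
    gcongr
  have p3 := ruzsa_triangle_inequality_add_add_add (-A + A) A B
  have e1 : -A + A + A = 2 • A - 1 • A := by
    rw [two_nsmul, one_nsmul, sub_eq_add_neg, add_assoc, add_comm]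
  rw [e1] at p3
  have p3' : ((-A + A + B).card : ℝ) * A.card ≤ (2 • A - 1 • A).card * (A + B).card := by
    exact_mod_cast p3
  have p4 : ((-A + A + B).card : ℝ) * (q / 2) ≤ (2 * L) ^ 3 * (L * q) * (L * q) := by
    calc ((-A + A + B).card : ℝ) * (q / 2) ≤ ((-A + A + B).card : ℝ) * A.card := by gcongr
      _ ≤ _ := p3'
      _ ≤ _ := by gcongr
  have p5 : ((-A + A + B).card : ℝ) * (q / 2) ≤ (16 * L ^ 5 * q) * (q / 2) := by
    refine p4.trans_eq ?_; ring
  exact le_of_mul_le_mul_right p5 (by positivity)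

open SimpleGraph TripartiteFromTriangles in
lemma aux_removal_core {G : Type} [AddCommGroup G] [DecidableEq G] (L ε : ℝ) (hL : 0 < L)
    (hε : 0 < ε) (A B U : Finset G)
    (q : ℝ) (hq : 0 < q) (hA : q / 2 ≤ A.card) (hB : q / 2 ≤ B.card)
    (hAB : ((A + B).card : ℝ) ≤ L * q)
    (M : Finset (G × G)) (hM : M ⊆ {p ∈ A ×ˢ B | p.1 + p.2 ∈ U})
    (h1 : Set.InjOn Prod.fst (M : Set (G × G)))
    (h2 : Set.InjOn Prod.snd (M : Set (G × G)))
    (h3 : Set.InjOn (fun p : G × G => p.1 + p.2) (M : Set (G × G)))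
    (hMc : ε * q ≤ M.card) :
    triangleRemovalBound (ε / (18 * (48 * L ^ 5) ^ 2)) * 27 / (8 * L) * q ^ 2 ≤
      #{p ∈ A ×ˢ B | p.1 + p.2 ∈ U} := by
  classical
  have hA0 : (0:ℝ) < A.card := by linarith
  have hB0 : (0:ℝ) < B.card := by linarith
  have hAne : A.Nonempty := card_pos.1 (by exact_mod_cast hA0)
  have hBne : B.Nonempty := card_pos.1 (by exact_mod_cast hB0)
  set S : Finset (G × G) := {p ∈ A ×ˢ B | p.1 + p.2 ∈ U} with hS
  have hAL : (A.card : ℝ) ≤ L * q := le_trans (by exact_mod_cast card_le_card_add_right hBne) hAB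
  have hpl := aux_plun A B L q hq hA hB hAB
  let V : Finset G := -A ∪ (-A + A) ∪ (-A + A + B)
  have hVc : (V.card : ℝ) ≤ 48 * L ^ 5 * q := by
    have c1 : (V.card : ℝ) ≤ (-A).card + (-A + A).card + (-A + A + B).card := by
      exact_mod_cast (card_union_le _ _).trans (Nat.add_le_add_right (card_union_le _ _) _)
    have c2 : (-A + A).card ≤ (-A + A + B).card := card_le_card_add_right hBne
    have c3 : (-A).card ≤ (-A + A).card := card_le_card_add_right hAne
    have c2' : ((-A + A).card : ℝ) ≤ (-A + A + B).card := by exact_mod_cast c2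
    have c3' : ((-A).card : ℝ) ≤ (-A + A).card := by exact_mod_cast c3
    linarith
  have hVl : q / 2 ≤ V.card := by
    refine hA.trans ?_
    rw [← card_neg A]
    exact_mod_cast card_le_card (subset_union_left.trans subset_union_left)
  have hV1 : ∀ x ∈ -A, x ∈ V := fun x hx => by simp only [V, mem_union]; tauto
  have hV2 : ∀ x ∈ -A, ∀ a ∈ A, x + a ∈ V := fun x hx a ha => by
    simp only [V, mem_union]; exact Or.inl (Or.inr (add_mem_add hx ha))
  have hV3 : ∀ x ∈ -A, ∀ a ∈ A, ∀ b ∈ B, x + a + b ∈ V := fun x hx a ha b hb => by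
    simp only [V, mem_union]; exact Or.inr (add_mem_add (add_mem_add hx ha) hb)
  have hMS : ∀ p ∈ M, p.1 ∈ A ∧ p.2 ∈ B ∧ p.1 + p.2 ∈ U := by
    intro p hp
    have := hM hp
    simp only [hS, mem_filter, mem_product] at this
    tauto
  let t : Finset (↥V × ↥V × ↥V) := {w | (w.1 : G) ∈ -A ∧ ((w.2.1 : G) - w.1, (w.2.2 : G) - w.2.1) ∈ M}
  have ht : ∀ x y z : ↥V, (x, y, z) ∈ t ↔ (x : G) ∈ -A ∧ ((y : G) - x, (z : G) - y) ∈ M := by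
    intro x y z; simp [t]
  have : ExplicitDisjoint t := by
    refine ⟨?_, ?_, ?_⟩
    · intro a b c a' u v
      rw [ht] at u v
      have := h2 u.2 v.2 rfl
      simp only [Prod.mk.injEq] at this
      exact Subtype.ext (sub_right_injective this.1)
    · intro a b c b' u v
      rw [ht] at u v
      have := h3 u.2 v.2 (by simp)
      simp only [Prod.mk.injEq] at this
      exact Subtype.ext (sub_left_injective this.1)
    · intro a b c c' u v
      rw [ht] at u v
      have := h1 u.2 v.2 rfl
      simp only [Prod.mk.injEq] at this
      exact Subtype.ext (sub_left_injective this.2)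
  have htc : A.card * M.card ≤ t.card := by
    rw [← card_neg A, ← card_product]
    refine card_le_card_of_injOn (fun w => if hw : w ∈ (-A) ×ˢ M then
      (⟨w.1, hV1 _ (mem_product.1 hw).1⟩, 
        ⟨w.1 + w.2.1, hV2 _ (mem_product.1 hw).1 _ (hMS _ (mem_product.1 hw).2).1⟩,
        ⟨w.1 + w.2.1 + w.2.2, hV3 _ (mem_product.1 hw).1 _ (hMS _ (mem_product.1 hw).2).1 _ 
          (hMS _ (mem_product.1 hw).2).2.1⟩) else 
      (⟨-hAne.choose, hV1 _ (neg_mem_neg hAne.choose_spec)⟩, 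
       ⟨-hAne.choose, hV1 _ (neg_mem_neg hAne.choose_spec)⟩,
       ⟨-hAne.choose, hV1 _ (neg_mem_neg hAne.choose_spec)⟩)) ?_ ?_
    · intro w hw
      rw [mem_coe] at hw
      simp only [hw, dif_pos, mem_coe]
      rw [ht]
      have := mem_product.1 hw
      simpa using this
    · intro w hw w' hw' heq
      rw [mem_coe] at hw hw'
      simp only [hw, hw', dif_pos, Prod.mk.injEq, Subtype.mk.injEq] at heq
      obtain ⟨e1, e2, e3⟩ := heq
      rw [e1] at e2 e3
      have e4 := add_left_cancel e2
      rw [e4] at e3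
      have e5 := add_left_cancel e3
      ext <;> assumption
  set ε₀ := ε / (18 * (48 * L ^ 5) ^ 2) with hε₀
  have hε₀pos : 0 < ε₀ := by positivity
  have far : (graph t).FarFromTriangleFree ε₀ := by
    refine farFromTriangleFree t ?_
    rw [Fintype.card_coe]
    push_cast
    have tr : (A.card : ℝ) * M.card ≤ t.card := by exact_mod_cast htc
    have : (q / 2) * (ε * q) ≤ t.card := by
      refine le_trans ?_ tr
      gcongr
    refine le_trans ?_ this
    calc ε₀ * ((V.card : ℝ) + V.card + V.card) ^ 2 
        ≤ ε₀ * (48 * L ^ 5 * q + 48 * L ^ 5 * q + 48 * L ^ 5 * q) ^ 2 := by gcongr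
      _ = (q / 2) * (ε * q) := by
        rw [hε₀]; field_simp; ring
  have low := far.le_card_cliqueFinset
  have cardV : (Fintype.card (↥V ⊕ ↥V ⊕ ↥V) : ℝ) = 3 * V.card := by
    simp only [Fintype.card_sum, Fintype.card_coe]; push_cast; ring
  rw [cardV] at low
  let W : Finset (↥V × ↥V × ↥V) := {w | (w.1 : G) ∈ -A ∧ ((w.2.1 : G) - w.1, (w.2.2 : G) - w.2.1) ∈ S}
  have hWc : W.card ≤ A.card * S.card := by
    rw [← card_neg A, ← card_product]
    refine card_le_card_of_injOn 
      (fun w => ((w.1 : G), ((w.2.1 : G) - w.1, (w.2.2 : G) - w.2.1))) ?_ ?_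
    · intro w hw
      simp only [W, mem_coe, mem_filter, mem_univ, true_and] at hw
      simp only [mem_coe, mem_product]
      exact hw
    · intro w _ w' _ heq
      simp only [Prod.mk.injEq] at heq
      obtain ⟨e1, e2, e3⟩ := heq
      rw [e1] at e2
      have e4 := sub_left_injective e2
      rw [e4] at e3
      have e5 := sub_left_injective e3
      exact Prod.ext (Subtype.ext e1) (Prod.ext (Subtype.ext e4) (Subtype.ext e5))
  have hcl : ((graph t).cliqueFinset 3).card ≤ W.card := by
    rw [← card_map toTriangle]
    refine card_le_card ?_
    intro s hs
    rw [mem_cliqueFinset_iff, is3Clique_iff] at hs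
    obtain ⟨x, y, z, hxy, hxz, hyz, rfl⟩ := hs
    obtain ⟨a, b, c, habc, hab, hac, hbc⟩ := graph_triple hxy hxz hyz
    rw [mem_map]
    refine ⟨(a, b, c), ?_, habc⟩
    obtain ⟨c', hc'⟩ := Graph.in₀₁_iff.1 hab
    obtain ⟨b', hb'⟩ := Graph.in₀₂_iff.1 hac
    obtain ⟨a', ha'⟩ := Graph.in₁₂_iff.1 hbc
    rw [ht] at hc' hb' ha'
    have i1 := hMS _ hc'.2
    have i2 := hMS _ hb'.2
    have i3 := hMS _ ha'.2
    simp only [W, mem_filter, mem_univ, true_and, hS, mem_product]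
    refine ⟨hc'.1, ⟨i1.1, i3.2.1⟩, ?_⟩
    have := i2.2.2
    simpa using this
  have hup : (((graph t).cliqueFinset 3).card : ℝ) ≤ L * q * S.card := by
    have : (((graph t).cliqueFinset 3).card : ℝ) ≤ A.card * S.card := by
      exact_mod_cast hcl.trans hWc
    refine this.trans ?_
    gcongr
  have hb := triangleRemovalBound_pos hε₀pos
  have fin : triangleRemovalBound ε₀ * (3 * (q / 2)) ^ 3 ≤ L * q * S.card := by
    refine le_trans ?_ (low.trans hup)
    gcongr
  have fin2 : (L * q) * (triangleRemovalBound ε₀ * 27 / (8 * L) * q ^ 2) ≤ (L * q) * S.card := by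
    refine le_trans (le_of_eq ?_) fin
    field_simp
    ring
  exact le_of_mul_le_mul_left fin2 (by positivity)

lemma aux_removal (L ε : ℝ) (hL : 0 < L) (hε : 0 < ε) : ∃ η : ℝ, 0 < η ∧
    ∀ (G : Type) [AddCommGroup G] [DecidableEq G] (A B U : Finset G)
    (q : ℝ) (_ : 0 < q) (_ : q / 2 ≤ A.card) (_ : q / 2 ≤ B.card)
    (_ : ((A + B).card : ℝ) ≤ L * q)
    (_ : (#{p ∈ A ×ˢ B | p.1 + p.2 ∈ U} : ℝ) ≤ η * q ^ 2),
    ∃ A0 B0 U0 : Finset G, (A0.card : ℝ) ≤ ε * q ∧ (B0.card : ℝ) ≤ ε * q ∧ (U0.card : ℝ) ≤ ε * q ∧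
      ∀ a ∈ A, ∀ b ∈ B, a + b ∈ U → a ∈ A0 ∨ b ∈ B0 ∨ a + b ∈ U0 := by
  have hb : 0 < SimpleGraph.triangleRemovalBound (ε / (18 * (48 * L ^ 5) ^ 2)) := 
    SimpleGraph.triangleRemovalBound_pos (by positivity)
  refine ⟨SimpleGraph.triangleRemovalBound (ε / (18 * (48 * L ^ 5) ^ 2)) * 27 / (8 * L) / 2, 
    by positivity, ?_⟩
  intro G _ _ A B U q hq hA hB hAB hS
  classical
  set S : Finset (G × G) := {p ∈ A ×ˢ B | p.1 + p.2 ∈ U} with hSdef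
  let F : Finset (Finset (G × G)) := {M ∈ S.powerset | Set.InjOn Prod.fst (M : Set (G × G)) ∧
    Set.InjOn Prod.snd (M : Set (G × G)) ∧ 
    Set.InjOn (fun p : G × G => p.1 + p.2) (M : Set (G × G))}
  have hF : F.Nonempty := ⟨∅, by simp [F]⟩
  obtain ⟨M, hMF, hmax⟩ := exists_max_image F card hF
  simp only [F, mem_filter, mem_powerset] at hMF hmax
  obtain ⟨hMS, h1, h2, h3⟩ := hMF
  have hMc : (M.card : ℝ) ≤ ε * q := by
    by_contra hcon
    push Not at hcon
    have := aux_removal_core L ε hL hε A B U q hq hA hB hAB M hMS h1 h2 h3 hcon.le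
    have pos : 0 < SimpleGraph.triangleRemovalBound (ε / (18 * (48 * L ^ 5) ^ 2)) * 27 / (8 * L) * q ^ 2 := by
      positivity
    linarith
  refine ⟨M.image Prod.fst, M.image Prod.snd, M.image (fun p => p.1 + p.2), ?_, ?_, ?_, ?_⟩
  · exact le_trans (by exact_mod_cast card_image_le) hMc
  · exact le_trans (by exact_mod_cast card_image_le) hMc
  · exact le_trans (by exact_mod_cast card_image_le) hMc
  · intro a ha b hb' hab
    by_contra hcon
    push Not at hcon
    obtain ⟨n1, n2, n3⟩ := hcon
    have hnot : (a, b) ∉ M := fun h => n1 (mem_image_of_mem Prod.fst h)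
    have := hmax (insert (a, b) M) ⟨?_, ?_, ?_, ?_⟩
    · rw [card_insert_of_notMem hnot] at this; omega
    · refine insert_subset ?_ hMS
      simp [hSdef, ha, hb', hab]
    · rw [coe_insert, Set.injOn_insert (by simpa using hnot)]
      exact ⟨h1, by rwa [← coe_image, mem_coe]⟩
    · rw [coe_insert, Set.injOn_insert (by simpa using hnot)]
      exact ⟨h2, by rwa [← coe_image, mem_coe]⟩
    · rw [coe_insert, Set.injOn_insert (by simpa using hnot)]
      exact ⟨h3, by rwa [← coe_image, mem_coe]⟩

lemma aux_clean {G : Type*} [AddCommGroup G] [DecidableEq G] (A B P : Finset G)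
    (hA : A.Nonempty) (hB : B.Nonempty) (θ : ℝ) (hθ8 : θ ≤ 1 / 8)
    (hE : (#{p ∈ A ×ˢ B | p.1 + p.2 ∉ P} : ℝ) ≤ θ * (A.card * B.card)) :
    ∃ A1 ⊆ A, ∃ B1 ⊆ B, (1 - 8 * θ) * A.card ≤ A1.card ∧ (1 - 8 * θ) * B.card ≤ B1.card ∧
      ((A1 + B1).card : ℝ) * (A.card * B.card) ≤ 2 * (P.card : ℝ) ^ 3 := by
  classical
  have hA0 : (0:ℝ) < A.card := by exact_mod_cast hA.card_pos
  have hB0 : (0:ℝ) < B.card := by exact_mod_cast hB.card_pos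
  set E : Finset (G × G) := {p ∈ A ×ˢ B | p.1 + p.2 ∉ P} with hEd
  let dA : G → ℕ := fun a => #{b ∈ B | a + b ∉ P}
  let dB : G → ℕ := fun b => #{a ∈ A | a + b ∉ P}
  have sA : E.card = ∑ a ∈ A, dA a := by
    simp only [hEd, dA, card_filter, sum_product]
  have sB : E.card = ∑ b ∈ B, dB b := by
    simp only [hEd, dB, card_filter, sum_product_right]
  let A1 : Finset G := {a ∈ A | (dA a : ℝ) ≤ B.card / 8}
  let B1 : Finset G := {b ∈ B | (dB b : ℝ) ≤ A.card / 8}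
  refine ⟨A1, filter_subset _ _, B1, filter_subset _ _, ?_, ?_, ?_⟩
  · have h1 : ((A \ A1).card : ℝ) * (B.card / 8) ≤ E.card := by
      rw [sA]; push_cast
      refine le_trans ?_ (sum_le_sum_of_subset_of_nonneg (sdiff_subset : A \ A1 ⊆ A)
        (fun _ _ _ => by positivity))
      rw [← nsmul_eq_mul]
      refine card_nsmul_le_sum _ _ _ ?_
      intro a ha
      simp only [A1, mem_sdiff, mem_filter, not_and, not_le] at ha
      exact (ha.2 ha.1).le
    have h2 : ((A \ A1).card : ℝ) = A.card - A1.card := by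
      rw [card_sdiff_of_subset (filter_subset _ _), Nat.cast_sub (card_le_card (filter_subset _ _))]
    have h3 : ((A \ A1).card : ℝ) * B.card ≤ (8 * θ * A.card) * B.card := by linarith
    have h4 := le_of_mul_le_mul_right h3 hB0
    linarith
  · have h1 : ((B \ B1).card : ℝ) * (A.card / 8) ≤ E.card := by
      rw [sB]; push_cast
      refine le_trans ?_ (sum_le_sum_of_subset_of_nonneg (sdiff_subset : B \ B1 ⊆ B)
        (fun _ _ _ => by positivity))
      rw [← nsmul_eq_mul]
      refine card_nsmul_le_sum _ _ _ ?_
      intro a ha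
      simp only [B1, mem_sdiff, mem_filter, not_and, not_le] at ha
      exact (ha.2 ha.1).le
    have h2 : ((B \ B1).card : ℝ) = B.card - B1.card := by
      rw [card_sdiff_of_subset (filter_subset _ _), Nat.cast_sub (card_le_card (filter_subset _ _))]
    have h3 : ((B \ B1).card : ℝ) * A.card ≤ (8 * θ * B.card) * A.card := by linarith
    have h4 := le_of_mul_le_mul_right h3 hA0
    linarith
  · let f : G × G × G → G := fun w => w.1 - w.2.1 + w.2.2
    let W : Finset (G × G × G) := {w ∈ P ×ˢ P ×ˢ P | f w ∈ A1 + B1}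
    have hW : W.card ≤ P.card ^ 3 := by
      refine (card_filter_le _ _).trans ?_
      rw [card_product, card_product]; apply le_of_eq; ring
    have hfib : W.card = ∑ x ∈ A1 + B1, #{w ∈ W | f w = x} := 
      card_eq_sum_card_fiberwise (fun w hw => (mem_filter.1 hw).2)
    have key : ∀ x ∈ A1 + B1, (A.card * B.card : ℝ) / 2 ≤ #{w ∈ W | f w = x} := by
      intro x hx
      obtain ⟨a, ha, b, hb, hab⟩ := mem_add.1 hx
      simp only [A1, B1, mem_filter] at ha hb
      let T : Finset (G × G) := {p ∈ A ×ˢ B | a + p.2 ∈ P ∧ p.1 + p.2 ∈ P ∧ p.1 + b ∈ P}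
      have hT : T.card ≤ #{w ∈ W | f w = x} := by
        refine card_le_card_of_injOn (fun p => (a + p.2, p.1 + p.2, p.1 + b)) ?_ ?_
        · intro p hp
          simp only [T, mem_coe, mem_filter] at hp
          have hfx : f (a + p.2, p.1 + p.2, p.1 + b) = x := by
            simp only [f]; rw [← hab]; abel
          simp only [W, mem_coe, mem_filter, mem_product]
          exact ⟨⟨hp.2, by rw [hfx]; exact hx⟩, hfx⟩
        · intro p _ p' _ heq
          simp only [Prod.mk.injEq] at heq
          exact Prod.ext (add_right_cancel heq.2.2) (add_left_cancel heq.1)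
      have hcov : A ×ˢ B ⊆ T ∪ (A ×ˢ {b' ∈ B | a + b' ∉ P} ∪ (E ∪ {a' ∈ A | a' + b ∉ P} ×ˢ B)) := by
        intro p hp
        simp only [T, hEd, mem_union, mem_filter, mem_product] at hp ⊢
        tauto
      have hc := (card_le_card hcov).trans ((card_union_le _ _).trans (Nat.add_le_add_left 
        ((card_union_le _ _).trans (Nat.add_le_add_left (card_union_le _ _) _)) _))
      rw [card_product, card_product, card_product] at hc
      have hc' : (A.card * B.card : ℝ) ≤ T.card + (A.card * dA a + (E.card + dB b * B.card)) := by
        exact_mod_cast hc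
      have i1 : (A.card * dA a : ℝ) ≤ A.card * (B.card / 8) := by gcongr; exact ha.2
      have i2 : (dB b * B.card : ℝ) ≤ (A.card / 8) * B.card := by gcongr; exact hb.2
      have i3 : θ * (A.card * B.card : ℝ) ≤ (1/8) * (A.card * B.card : ℝ) := by gcongr
      have i4 : (T.card : ℝ) ≤ #{w ∈ W | f w = x} := by exact_mod_cast hT
      have i5 : (0:ℝ) < A.card * B.card := by positivity
      linarith
    have h5 : ((A1 + B1).card : ℝ) * ((A.card * B.card : ℝ) / 2) ≤ W.card := by
      rw [hfib]; push_cast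
      rw [← nsmul_eq_mul]
      exact card_nsmul_le_sum _ _ _ key
    have h6 : (W.card : ℝ) ≤ (P.card : ℝ) ^ 3 := by exact_mod_cast hW
    linarith

lemma aux_split {G : Type*} [AddCommGroup G] [DecidableEq G] (A B : Finset G)
    (c δ q K : ℝ) (hc : 0 < c) (hδ : 0 < δ) (hq : 0 < q) (hcδ : 3 ≤ c * δ)
    (h : ∑ x ∈ A + B, c * repCount A B x / (c * repCount A B x + 3 * q) ≤ K * q) :
    (#{x ∈ A + B | δ * q ≤ repCount A B x} : ℝ) ≤ 2 * K * q ∧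
    (#{p ∈ A ×ˢ B | p.1 + p.2 ∉ ({x ∈ A + B | δ * q ≤ repCount A B x} : Finset G)} : ℝ)
       ≤ 2 * δ * K * q ^ 2 := by
  have hnn : ∀ x, 0 ≤ c * repCount A B x / (c * repCount A B x + 3 * q) := fun x => by positivity
  constructor
  · set P : Finset G := {x ∈ A + B | δ * q ≤ repCount A B x} with hP
    have h1 : P.card • (1/2 : ℝ) ≤ K * q := by
      refine le_trans (card_nsmul_le_sum P 
        (fun x => c * repCount A B x / (c * repCount A B x + 3 * q)) _ ?_) (le_trans 
        (sum_le_sum_of_subset_of_nonneg (filter_subset _ _) (fun x _ _ => hnn x)) h)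
      intro x hx
      have := (mem_filter.1 hx).2
      rw [le_div_iff₀ (by positivity)]
      nlinarith
    rw [nsmul_eq_mul] at h1
    linarith
  · set Q : Finset (G × G) := 
      {p ∈ A ×ˢ B | p.1 + p.2 ∉ ({x ∈ A + B | δ * q ≤ repCount A B x} : Finset G)} with hQ
    let U : Finset G := {x ∈ A + B | ¬ (δ * q ≤ repCount A B x)}
    have hfib : Q.card = ∑ x ∈ U, #{p ∈ Q | p.1 + p.2 = x} := by
      refine card_eq_sum_card_fiberwise (f := fun p : G × G => p.1 + p.2) (fun p hp => ?_)
      simp only [hQ, U, mem_coe, mem_filter, mem_product, not_and] at hp ⊢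
      have := add_mem_add hp.1.1 hp.1.2
      exact ⟨this, hp.2 this⟩
    have h2 : (Q.card : ℝ) ≤ ∑ x ∈ U, (2 * δ * q) * (c * repCount A B x / (c * repCount A B x + 3 * q)) := by
      rw [hfib]; push_cast
      refine sum_le_sum fun x hx => ?_
      have hx2 := (mem_filter.1 hx).2
      push Not at hx2
      have : #{p ∈ Q | p.1 + p.2 = x} ≤ repCount A B x := by
        refine card_le_card ?_
        intro p hp
        simp only [hQ, mem_filter] at hp ⊢
        exact ⟨hp.1.1, hp.2⟩
      have : (#{p ∈ Q | p.1 + p.2 = x} : ℝ) ≤ repCount A B x := by exact_mod_cast this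
      refine this.trans ?_
      rw [mul_div_assoc', le_div_iff₀ (by positivity)]
      have hr : (0:ℝ) ≤ repCount A B x := by positivity
      have i1 : c * repCount A B x + 3 * q ≤ 2 * (c * δ) * q := by nlinarith
      nlinarith [mul_le_mul_of_nonneg_left i1 hr]
    rw [← mul_sum] at h2
    have h3 : ∑ x ∈ U, (c * repCount A B x / (c * repCount A B x + 3 * q)) ≤ K * q :=
      (sum_le_sum_of_subset_of_nonneg (filter_subset _ _) (fun x _ _ => hnn x)).trans h
    have h4 := mul_le_mul_of_nonneg_left h3 (by positivity : 0 ≤ 2 * δ * q)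
    refine (h2.trans h4).trans_eq ?_
    ring

lemma aux_extremal (L ε : ℝ) (hL : 0 < L) (hε : 0 < ε) (hε1 : ε < 1) : ∃ δ : ℝ, 0 < δ ∧
    ∀ (G : Type) [AddCommGroup G] [DecidableEq G] (A B : Finset G)
    (q : ℝ) (_ : 0 < q) (_ : 3 / 4 * q ≤ A.card) (_ : 3 / 4 * q ≤ B.card)
    (_ : ((A + B).card : ℝ) ≤ L * q),
    ∃ A1 ⊆ A, ∃ B1 ⊆ B, (A.card : ℝ) - A1.card ≤ ε / 4 * q ∧ (B.card : ℝ) - B1.card ≤ ε / 4 * q ∧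
      (#{x ∈ A1 + B1 | (repCount A1 B1 x : ℝ) < δ * q} : ℝ) ≤ ε / 4 * q := by
  set lam : ℝ := 4 * L / ε with hlam
  have hlam0 : 0 < lam := by positivity
  set ε2 : ℝ := ε / (4 * (1 + 2 * lam)) with hε2
  have hε20 : 0 < ε2 := by positivity
  obtain ⟨η, hη, hrem⟩ := aux_removal L ε2 hL hε20
  refine ⟨η / L, by positivity, ?_⟩
  intro G _ _ A B q hq hA hB hAB
  classical
  let F : Finset G × Finset G → ℝ := fun p => 
    ((p.1 + p.2).card : ℝ) + lam * ((A.card - p.1.card) + (B.card - p.2.card))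
  obtain ⟨⟨A1, B1⟩, hmem, hmin⟩ := exists_min_image (A.powerset ×ˢ B.powerset) F 
    ⟨(A, B), by simp⟩
  simp only [mem_product, mem_powerset] at hmem
  obtain ⟨hA1, hB1⟩ := hmem
  have hA1c : (A1.card : ℝ) ≤ A.card := by exact_mod_cast card_le_card hA1
  have hB1c : (B1.card : ℝ) ≤ B.card := by exact_mod_cast card_le_card hB1
  have h0 := hmin (A, B) (by simp)
  simp only [F] at h0
  have hS0 : (0:ℝ) ≤ (A1 + B1).card := by positivity
  have hlamL : lam * (ε / 4 * q) = L * q := by rw [hlam]; field_simp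
  have hrm : ((A.card : ℝ) - A1.card) + (B.card - B1.card) ≤ ε / 4 * q := by
    have : lam * (((A.card : ℝ) - A1.card) + (B.card - B1.card)) ≤ lam * (ε / 4 * q) := by
      rw [hlamL]; linarith
    exact le_of_mul_le_mul_left this hlam0
  have hεq : ε / 4 * q ≤ 1 / 4 * q := by gcongr
  have hAB1 : ((A1 + B1).card : ℝ) ≤ L * q := by
    refine le_trans ?_ hAB
    exact_mod_cast card_le_card (add_subset_add hA1 hB1)
  refine ⟨A1, hA1, B1, hB1, by linarith, by linarith, ?_⟩
  set U : Finset G := {x ∈ A1 + B1 | (repCount A1 B1 x : ℝ) < η / L * q} with hU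
  have hsol : (#{p ∈ A1 ×ˢ B1 | p.1 + p.2 ∈ U} : ℝ) ≤ η * q ^ 2 := by
    set Q : Finset (G × G) := {p ∈ A1 ×ˢ B1 | p.1 + p.2 ∈ U} with hQ
    have hfib : Q.card = ∑ x ∈ U, #{p ∈ Q | p.1 + p.2 = x} := 
      card_eq_sum_card_fiberwise (f := fun p : G × G => p.1 + p.2) 
        (fun p hp => (mem_filter.1 hp).2)
    have h2 : (Q.card : ℝ) ≤ ∑ x ∈ U, η / L * q := by
      rw [hfib]; push_cast
      refine sum_le_sum fun x hx => ?_
      have : #{p ∈ Q | p.1 + p.2 = x} ≤ repCount A1 B1 x := by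
        refine card_le_card ?_
        intro p hp
        simp only [hQ, mem_filter] at hp ⊢
        exact ⟨hp.1.1, hp.2⟩
      have : (#{p ∈ Q | p.1 + p.2 = x} : ℝ) ≤ repCount A1 B1 x := by exact_mod_cast this
      exact this.trans (mem_filter.1 hx).2.le
    rw [sum_const, nsmul_eq_mul] at h2
    have hUc : (U.card : ℝ) ≤ L * q := by
      refine le_trans ?_ hAB1
      exact_mod_cast card_le_card (filter_subset _ _)
    refine h2.trans ?_
    calc (U.card : ℝ) * (η / L * q) ≤ (L * q) * (η / L * q) := by gcongr
      _ = η * q ^ 2 := by field_simp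
  obtain ⟨A0, B0, U0, hA0, hB0, hU0, hno⟩ := hrem G A1 B1 U q hq (by linarith) (by linarith) hAB1 hsol
  have h1 := hmin (A1 \ A0, B1 \ B0) (by
    simp only [mem_product, mem_powerset]
    exact ⟨sdiff_subset.trans hA1, sdiff_subset.trans hB1⟩)
  simp only [F] at h1
  have hsum : ((A1 \ A0) + (B1 \ B0)).card + U.card ≤ (A1 + B1).card + U0.card := by
    have s1 : ((A1 \ A0) + (B1 \ B0)) ⊆ ((A1 + B1) \ U) ∪ U0 := by
      intro x hx
      obtain ⟨a, ha, b, hb, rfl⟩ := mem_add.1 hx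
      rw [mem_sdiff] at ha hb
      rw [mem_union, mem_sdiff]
      by_cases hxU : a + b ∈ U
      · have := hno a ha.1 b hb.1 hxU
        tauto
      · exact Or.inl ⟨add_mem_add ha.1 hb.1, hxU⟩
    have s2 := (card_le_card s1).trans (card_union_le _ _)
    have hUs : U ⊆ A1 + B1 := filter_subset _ _
    have s3 := card_sdiff_add_card_eq_card hUs
    omega
  have hsum' : (((A1 \ A0) + (B1 \ B0)).card : ℝ) + U.card ≤ (A1 + B1).card + U0.card := by
    exact_mod_cast hsum
  have dA : (A1.card : ℝ) ≤ (A1 \ A0).card + A0.card := by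
    exact_mod_cast card_le_card_sdiff_add_card
  have dB : (B1.card : ℝ) ≤ (B1 \ B0).card + B0.card := by
    exact_mod_cast card_le_card_sdiff_add_card
  have l1 : lam * (((A.card : ℝ) - (A1 \ A0).card) + (B.card - (B1 \ B0).card)) ≤ 
      lam * ((A.card - A1.card) + (B.card - B1.card)) + lam * (2 * (ε2 * q)) := by
    rw [← mul_add]
    refine mul_le_mul_of_nonneg_left ?_ hlam0.le
    linarith
  have l2 : (U.card : ℝ) ≤ ε2 * q + lam * (2 * (ε2 * q)) := by linarith
  refine l2.trans_eq ?_
  rw [hε2]; field_simp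

set_option maxHeartbeats 2000000 in
theorem stmt2 (K ε : ℝ) (hε : 0 < ε) :
    ∃ c : ℝ, 0 < c ∧
      ∀ (G : Type) [AddCommGroup G] [DecidableEq G] (A B : Finset G),
        A.Nonempty → B.Nonempty →
        ∀ c₁ c₂ : ℕ, 1 ≤ c₁ → c₁ ≤ A.card → 1 ≤ c₂ → c₂ ≤ B.card →
          c * (max A.card B.card : ℕ) ≤ (c₁ * c₂ : ℝ) →
          ∃ Astar ⊆ A, ∃ Bstar ⊆ B,
            (1 - ε) * A.card ≤ (Astar.card : ℝ) ∧
            (1 - ε) * B.card ≤ (Bstar.card : ℝ) ∧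
            min ((1 - ε) * ((Astar + Bstar).card : ℝ))
                (min (K * Astar.card) (K * Bstar.card)) ≤
              (∑ f : Fin c₁ → ↥Astar, ∑ g : Fin c₂ → ↥Bstar,
                  ((Finset.image (fun i => (f i : G)) Finset.univ +
                    Finset.image (fun j => (g j : G)) Finset.univ).card : ℝ)) /
                ((Astar.card : ℝ) ^ c₁ * (Bstar.card : ℝ) ^ c₂) := by
  by_cases hε1 : 1 ≤ ε
  · refine ⟨1, one_pos, ?_⟩
    intro G _ _ A B _ _ c₁ c₂ _ _ _ _ _
    have hA0 : (0:ℝ) ≤ A.card := by positivity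
    have hB0 : (0:ℝ) ≤ B.card := by positivity
    refine ⟨A, Subset.rfl, B, Subset.rfl, by nlinarith, by nlinarith, ?_⟩
    refine (min_le_left _ _).trans (le_trans (b := (0:ℝ)) ?_ ?_)
    · have : (0:ℝ) ≤ (A + B).card := by positivity
      nlinarith
    · exact div_nonneg (sum_nonneg fun _ _ => sum_nonneg fun _ _ => Nat.cast_nonneg _) (by positivity)
  push Not at hε1
  set K' : ℝ := max K 1 with hK'
  have hK1 : 1 ≤ K' := le_max_right _ _
  have hKK : K ≤ K' := le_max_left _ _
  have hK0 : 0 < K' := by linarith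
  set θ : ℝ := ε / 32 with hθ
  have hθ0 : 0 < θ := by positivity
  set δ : ℝ := θ / (2 * K') with hδ
  have hδ0 : 0 < δ := by positivity
  set L : ℝ := 16 * K' ^ 3 with hL
  have hL0 : 0 < L := by positivity
  obtain ⟨δ2, hδ2, hext⟩ := aux_extremal L ε hL0 hε hε1
  set c : ℝ := 3 / δ + 6 / (ε * δ2) with hc
  have hc0 : 0 < c := by positivity
  have hcδ : 3 ≤ c * δ := by
    have : 3 / δ * δ ≤ c * δ := by
      gcongr
      rw [hc]
      have : 0 < 6 / (ε * δ2) := by positivity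
      linarith
    rwa [div_mul_cancel₀ _ hδ0.ne'] at this
  have hcδ2 : 6 / ε ≤ c * δ2 := by
    have : 6 / (ε * δ2) * δ2 ≤ c * δ2 := by
      gcongr
      rw [hc]
      have : 0 < 3 / δ := by positivity
      linarith
    refine le_trans (le_of_eq ?_) this
    field_simp
  refine ⟨c, hc0, ?_⟩
  intro G _ _ A B hA hB k l hk hkA hl hlB hkl
  have hA0 : (0:ℝ) < A.card := by exact_mod_cast hA.card_pos
  have hB0 : (0:ℝ) < B.card := by exact_mod_cast hB.card_pos
  set q : ℝ := min (A.card : ℝ) B.card with hq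
  have hq0 : 0 < q := lt_min hA0 hB0
  have hqA : q ≤ A.card := min_le_left _ _
  have hqB : q ≤ B.card := min_le_right _ _
  have hkA' : (k:ℝ) ≤ A.card := by exact_mod_cast hkA
  have hlB' : (l:ℝ) ≤ B.card := by exact_mod_cast hlB
  rw [Nat.cast_max] at hkl
  have hex := aux_expect A B hA hB A.card B.card le_rfl le_rfl k l hk hl hkA' hlB' c hc0 hkl
  rw [← hq] at hex
  by_cases hcase : ∑ x ∈ A + B, c * repCount A B x / (c * repCount A B x + 3 * q) ≤ K' * q
  swap
  · push Not at hcase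
    refine ⟨A, Subset.rfl, B, Subset.rfl, by nlinarith, by nlinarith, ?_⟩
    refine (min_le_right _ _).trans (le_trans ?_ (hcase.le.trans hex))
    rcases min_choice (A.card : ℝ) B.card with h | h
    · rw [hq, h]; exact (min_le_left _ _).trans (by gcongr)
    · rw [hq, h]; exact (min_le_right _ _).trans (by gcongr)
  obtain ⟨hP, hE⟩ := aux_split A B c δ q K' hc0 hδ0 hq0 hcδ hcase
  set P : Finset G := {x ∈ A + B | δ * q ≤ repCount A B x} with hPdef
  have hqq : q ^ 2 ≤ A.card * B.card := by rw [sq]; gcongr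
  have hE' : (#{p ∈ A ×ˢ B | p.1 + p.2 ∉ P} : ℝ) ≤ θ * (A.card * B.card) := by
    refine hE.trans ?_
    have : 2 * δ * K' = θ := by rw [hδ]; field_simp
    rw [this]; gcongr
  obtain ⟨A1, hA1, B1, hB1, hA1c, hB1c, hAB1⟩ := aux_clean A B P hA hB θ (by rw [hθ]; linarith) hE'
  have h8 : 8 * θ = ε / 4 := by rw [hθ]; ring
  rw [h8] at hA1c hB1c
  have hAB1' : ((A1 + B1).card : ℝ) ≤ L * q := by
    have h1 : ((A1 + B1).card : ℝ) * q ^ 2 ≤ (L * q) * q ^ 2 := by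
      calc ((A1 + B1).card : ℝ) * q ^ 2 ≤ ((A1 + B1).card : ℝ) * (A.card * B.card) := by gcongr
        _ ≤ 2 * (P.card : ℝ) ^ 3 := hAB1
        _ ≤ 2 * (2 * K' * q) ^ 3 := by gcongr
        _ = _ := by rw [hL]; ring
    exact le_of_mul_le_mul_right h1 (by positivity)
  obtain ⟨A2, hA2, B2, hB2, hA2c, hB2c, hU⟩ := hext G A1 B1 q hq0 (by nlinarith) (by nlinarith) hAB1'
  have hεqA : ε / 4 * q ≤ ε / 4 * A.card := by gcongr
  have hεqB : ε / 4 * q ≤ ε / 4 * B.card := by gcongr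
  have hA2h : (1 - ε / 2) * A.card ≤ A2.card := by linarith
  have hB2h : (1 - ε / 2) * B.card ≤ B2.card := by linarith
  have hA2q : q / 2 ≤ A2.card := by nlinarith
  have hB2q : q / 2 ≤ B2.card := by nlinarith
  have hA2ne : A2.Nonempty := card_pos.1 (by exact_mod_cast (by linarith : (0:ℝ) < A2.card))
  have hB2ne : B2.Nonempty := card_pos.1 (by exact_mod_cast (by linarith : (0:ℝ) < B2.card))
  refine ⟨A2, hA2.trans hA1, B2, hB2.trans hB1, by nlinarith, by nlinarith, ?_⟩
  refine (min_le_left _ _).trans ?_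
  refine le_trans ?_ (aux_expect A2 B2 hA2ne hB2ne A.card B.card 
    (by exact_mod_cast card_le_card (hA2.trans hA1)) (by exact_mod_cast card_le_card (hB2.trans hB1)) 
    k l hk hl hkA' hlB' c hc0 hkl)
  rw [← hq]
  set U : Finset G := {x ∈ A2 + B2 | (repCount A2 B2 x : ℝ) < δ2 * q} with hUd
  have hUs : U ⊆ A2 + B2 := filter_subset _ _
  have hpop : ((A2 + B2) \ U).card • (1 - ε / 2) ≤ 
      ∑ x ∈ A2 + B2, c * repCount A2 B2 x / (c * repCount A2 B2 x + 3 * q) := by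
    refine le_trans (card_nsmul_le_sum ((A2 + B2) \ U) 
      (fun x => c * repCount A2 B2 x / (c * repCount A2 B2 x + 3 * q)) _ ?_)
      (sum_le_sum_of_subset_of_nonneg sdiff_subset (fun x _ _ => by positivity))
    intro x hx
    simp only [hUd, mem_sdiff, mem_filter, not_and, not_lt] at hx
    have hr := hx.2 hx.1
    rw [le_div_iff₀ (by positivity)]
    have j1 : 6 / ε * q ≤ c * repCount A2 B2 x := by
      calc 6 / ε * q ≤ c * δ2 * q := by gcongr
        _ = c * (δ2 * q) := by ring
        _ ≤ _ := by gcongr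
    have j2 : 6 * q ≤ ε * (c * repCount A2 B2 x) := by
      calc 6 * q = ε * (6 / ε * q) := by field_simp
        _ ≤ _ := by gcongr
    nlinarith
  rw [nsmul_eq_mul, card_sdiff_of_subset hUs, Nat.cast_sub (card_le_card hUs)] at hpop
  refine le_trans ?_ hpop
  have hS : q / 2 ≤ (A2 + B2).card := hA2q.trans (by exact_mod_cast card_le_card_add_right hB2ne)
  have hU' : (U.card : ℝ) ≤ ε / 2 * (A2 + B2).card := by
    refine hU.trans ?_
    nlinarith
  have hS0 : (0:ℝ) ≤ (A2 + B2).card := by positivity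
  have : (1 - ε / 2) * (A2 + B2).card ≤ (A2 + B2).card - (U.card : ℝ) := by linarith
  calc (1 - ε) * ((A2 + B2).card : ℝ) ≤ ((1 - ε / 2) * (A2 + B2).card) * (1 - ε / 2) := by nlinarith [mul_nonneg (sq_nonneg ε) hS0]
    _ ≤ _ := by gcongr; linarith
end

section
/- There exists γ > 0 such that for all α > 0 there exists c for which the following holds. Let X and Y be subsets of intervals I and J in Z_p (p prime), and let 1 ≤ c₁ ≤ |X| and 1 ≤ c₂ ≤ |Y| be integers with c₁c₂ ≥ c·max(|X|, |Y|). Suppose α|J| ≤ |I| ≤ α⁻¹|J|, |I| + |J| ≤ p, and max(|I \ X|, |J \ Y|) ≤ γ·min(|I|, |J|). Then there exist X' ⊆ X with |X'| = c₁ and Y' ⊆ Y with |Y'| = c₂ such that |X' + Y'| ≥ |X| + |Y| − 1. -/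
open Finset Pointwise

/-- The interval `{a, a+1, ..., a+n-1}` in `ZMod p`. -/
def zmodInterval (p : ℕ) (a : ZMod p) (n : ℕ) : Finset (ZMod p) :=
  (Finset.range n).image (fun i : ℕ => a + (i : ZMod p))

open Classical in
lemma avg_lem {Ω ι : Type*} (Om : Finset Ω) (hne : Om.Nonempty) (M : Finset ι) (good : Ω → ι → Prop)
    (g : ℕ) (h : ∀ z ∈ M, g ≤ (Om.filter (fun w => good w z)).card) :
    ∃ w ∈ Om, (M.filter (fun z => ¬ good w z)).card * Om.card + g * M.card ≤ Om.card * M.card := by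
  by_contra hcon
  push Not at hcon
  have e1 : ∑ w ∈ Om, (M.filter (fun z => good w z)).card
      = ∑ z ∈ M, (Om.filter (fun w => good w z)).card := by
    simp only [Finset.card_filter]
    exact Finset.sum_comm
  have e2 : M.card * g ≤ ∑ z ∈ M, (Om.filter (fun w => good w z)).card := by
    have := Finset.card_nsmul_le_sum M (fun z => (Om.filter (fun w => good w z)).card) g h
    simpa using this
  have e3 : ∀ w ∈ Om, (M.filter (fun z => good w z)).card * Om.card < g * M.card := by
    intro w hw
    have h1 := hcon w hw
    have h2 := Finset.card_filter_add_card_filter_not (s := M) (fun z => good w z)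
    nlinarith
  have e4 : ∑ w ∈ Om, (M.filter (fun z => good w z)).card * Om.card < ∑ w ∈ Om, g * M.card :=
    Finset.sum_lt_sum_of_nonempty hne e3
  rw [← Finset.sum_mul, e1, Finset.sum_const, smul_eq_mul] at e4
  nlinarith [hne.card_pos]

noncomputable def ho (S : Finset ℤ) (a b : ℤ) : ℕ := (Finset.Ico a b \ S).card

lemma ho_mono (S : Finset ℤ) {a b a' b' : ℤ} (h1 : a' ≤ a) (h2 : b ≤ b') : ho S a b ≤ ho S a' b' := by
  apply Finset.card_le_card
  intro x hx
  simp only [Finset.mem_sdiff, Finset.mem_Ico] at *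
  exact ⟨⟨by omega, by omega⟩, hx.2⟩

lemma ho_add (S : Finset ℤ) {a b c : ℤ} (h1 : a ≤ b) (h2 : b ≤ c) : ho S a c = ho S a b + ho S b c := by
  unfold ho
  rw [← Finset.card_union_of_disjoint]
  · congr 1
    ext x
    simp only [Finset.mem_sdiff, Finset.mem_Ico, Finset.mem_union]
    constructor
    · rintro ⟨h, hs⟩
      by_cases hx : x < b
      · left; exact ⟨⟨h.1, hx⟩, hs⟩
      · right; exact ⟨⟨by omega, h.2⟩, hs⟩
    · rintro (⟨h, hs⟩ | ⟨h, hs⟩)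
      · exact ⟨⟨h.1, by omega⟩, hs⟩
      · exact ⟨⟨by omega, h.2⟩, hs⟩
  · rw [Finset.disjoint_left]
    intro x hx hy
    simp only [Finset.mem_sdiff, Finset.mem_Ico] at *
    omega

lemma ho_card (S : Finset ℤ) {a b : ℤ} (h : a ≤ b) :
    ((S ∩ Finset.Ico a b).card : ℤ) + ho S a b = b - a := by
  have h1 := Finset.card_inter_add_card_sdiff (Finset.Ico a b) S
  rw [Finset.inter_comm] at h1
  have h2 : (Finset.Ico a b).card = (b - a).toNat := Int.card_Ico a b
  unfold ho
  omega

lemma reps_lem (X Y : Finset ℤ) (z a c : ℤ) (h : a ≤ c) :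
    c - a ≤ (((X ∩ Finset.Ico a c).filter (fun x => z - x ∈ Y)).card : ℤ) + ho X a c
      + ho Y (z - c + 1) (z - a + 1) := by
  have h2 : (Finset.Ico a c).card = (c - a).toNat := Int.card_Ico a c
  have h3 : Finset.Ico a c ⊆ ((X ∩ Finset.Ico a c).filter (fun x => z - x ∈ Y)) ∪
      (Finset.Ico a c \ X) ∪ ((Finset.Ico (z - c + 1) (z - a + 1) \ Y).image (fun y => z - y)) := by
    intro x hx
    simp only [Finset.mem_union, Finset.mem_filter, Finset.mem_inter, Finset.mem_sdiff,
      Finset.mem_image]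
    by_cases hX : x ∈ X
    · by_cases hY : z - x ∈ Y
      · left; left; exact ⟨⟨hX, hx⟩, hY⟩
      · right
        refine ⟨z - x, ⟨?_, hY⟩, by ring⟩
        simp only [Finset.mem_Ico] at *
        omega
    · left; right; exact ⟨hx, hX⟩
  have h4 := Finset.card_le_card h3
  have h5 := Finset.card_union_le (((X ∩ Finset.Ico a c).filter (fun x => z - x ∈ Y)) ∪
      (Finset.Ico a c \ X)) ((Finset.Ico (z - c + 1) (z - a + 1) \ Y).image (fun y => z - y))
  have h6 := Finset.card_union_le ((X ∩ Finset.Ico a c).filter (fun x => z - x ∈ Y))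
      (Finset.Ico a c \ X)
  have h7 : ((Finset.Ico (z - c + 1) (z - a + 1) \ Y).image (fun y => z - y)).card ≤ _ :=
    Finset.card_image_le
  unfold ho
  omega

lemma step_lem (X Y M : Finset ℤ) (a b : ℤ) (k s r g : ℕ) (hk : 0 < k) (hs : 0 < s)
    (h : ∀ z ∈ M, g ≤ ((X ∩ Finset.Ico a (a + k * s)).filter
      (fun x => z - x ∈ Y ∩ Finset.Ico b (b + k * r))).card) :
    ∃ X' ⊆ X, ∃ Y' ⊆ Y, X'.card ≤ k ∧ Y'.card ≤ r ∧
      (M \ (X' + Y')).card * (k * s) + g * M.card ≤ k * s * M.card := by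
  classical
  have hkz : (0 : ℤ) < k := by exact_mod_cast hk
  let P : ℕ → Finset ℤ := fun i => X ∩ Finset.Ico (a + k * i) (a + k * i + k)
  let Q : ℕ → Finset ℤ := fun v => (Y ∩ Finset.Ico b (b + k * r)).filter (fun y => y % k = v)
  obtain ⟨w, hw, hw2⟩ := avg_lem (Finset.range s ×ˢ Finset.range k)
    (by simp [Finset.nonempty_product]; omega) M (fun w z => z ∈ P w.1 + Q w.2) g (by
      intro z hz
      refine (h z hz).trans ?_
      apply Finset.card_le_card_of_injOn (fun x => (((x - a) / k).toNat, ((z - x) % k).toNat))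
      · intro x hx
        simp only [Finset.coe_filter, Finset.mem_inter, Finset.mem_Ico, Set.mem_ofPred_eq] at hx
        obtain ⟨⟨hxX, hx1, hx2⟩, hxY, hx3, hx4⟩ := hx
        have d0 : 0 ≤ (x - a) / k := Int.ediv_nonneg (by omega) (by omega)
        have d1 : (x - a) / k < s := by
          apply Int.ediv_lt_of_lt_mul hkz
          nlinarith
        have m0 := Int.emod_nonneg (z - x) hkz.ne'
        have m1 := Int.emod_lt_of_pos (z - x) hkz
        simp only [Finset.coe_filter, Finset.mem_product, Finset.mem_range, Set.mem_ofPred_eq]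
        refine ⟨⟨by omega, by omega⟩, ?_⟩
        rw [Finset.mem_add]
        refine ⟨x, ?_, z - x, ?_, by ring⟩
        · simp only [P, Finset.mem_inter, Finset.mem_Ico]
          have e := Int.mul_ediv_add_emod (x - a) k
          have n0 := Int.emod_nonneg (x - a) hkz.ne'
          have n1 := Int.emod_lt_of_pos (x - a) hkz
          rw [Int.toNat_of_nonneg d0]
          exact ⟨hxX, by omega, by omega⟩
        · simp only [Q, Finset.mem_filter, Finset.mem_inter, Finset.mem_Ico]
          exact ⟨⟨hxY, hx3, hx4⟩, by omega⟩
      · intro x hx x' hx' he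
        simp only [Finset.coe_filter, Finset.mem_inter, Finset.mem_Ico, Set.mem_ofPred_eq] at hx hx'
        simp only [Prod.mk.injEq] at he
        have d0 : 0 ≤ (x - a) / k := Int.ediv_nonneg (by omega) (by omega)
        have d0' : 0 ≤ (x' - a) / k := Int.ediv_nonneg (by omega) (by omega)
        have m0 := Int.emod_nonneg (z - x) hkz.ne'
        have m0' := Int.emod_nonneg (z - x') hkz.ne'
        have e1 : (x - a) / k = (x' - a) / k := by omega
        have e2 : (z - x) % k = (z - x') % k := by omega
        have e3 : (x - a) % k = (x' - a) % k := by
          have : (z - a - (z - x)) % k = (z - a - (z - x')) % k := by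
            rw [Int.sub_emod, e2, ← Int.sub_emod]
          have h1 : z - a - (z - x) = x - a := by ring
          have h2 : z - a - (z - x') = x' - a := by ring
          rwa [h1, h2] at this
        have f1 := Int.mul_ediv_add_emod (x - a) k
        have f2 := Int.mul_ediv_add_emod (x' - a) k
        rw [e1, e3] at f1
        omega)
  refine ⟨P w.1, Finset.inter_subset_left, Q w.2,
    (Finset.filter_subset _ _).trans Finset.inter_subset_left, ?_, ?_, ?_⟩
  · refine (Finset.card_le_card Finset.inter_subset_right).trans ?_
    rw [Int.card_Ico]; omega
  · have : (Q w.2).card ≤ (Finset.range r).card := by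
      apply Finset.card_le_card_of_injOn (fun y => ((y - b) / k).toNat)
      · intro y hy
        simp only [Q, Finset.coe_filter, Finset.mem_inter, Finset.mem_Ico, Set.mem_ofPred_eq] at hy
        have d0 : 0 ≤ (y - b) / k := Int.ediv_nonneg (by omega) (by omega)
        have d1 : (y - b) / k < r := by
          apply Int.ediv_lt_of_lt_mul hkz
          nlinarith
        simp only [Finset.coe_range, Set.mem_Iio]
        omega
      · intro x hx x' hx' he
        simp only [Q, Finset.coe_filter, Finset.mem_inter, Finset.mem_Ico, Set.mem_ofPred_eq] at hx hx'
        simp only at he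
        have d0 : 0 ≤ (x - b) / k := Int.ediv_nonneg (by omega) (by omega)
        have d0' : 0 ≤ (x' - b) / k := Int.ediv_nonneg (by omega) (by omega)
        have e1 : (x - b) / k = (x' - b) / k := by omega
        have e3 : (x - b) % k = (x' - b) % k := by
          rw [Int.sub_emod, hx.2, ← hx'.2, ← Int.sub_emod]
        have f1 := Int.mul_ediv_add_emod (x - b) k
        have f2 := Int.mul_ediv_add_emod (x' - b) k
        rw [e1, e3] at f1
        omega
    simpa using this
  · have e : M.filter (fun z => ¬ z ∈ P w.1 + Q w.2) = M \ (P w.1 + Q w.2) := by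
      ext z; simp
    rw [Finset.card_product, Finset.card_range, Finset.card_range, mul_comm s k] at hw2
    rw [← e]
    convert hw2

lemma iter_lem (X Y M : Finset ℤ) (a b : ℤ) (k s r q : ℕ) (hk : 0 < k) (hs : 0 < s)
    (h : ∀ z ∈ M, k * s ≤ (q + 1) * ((X ∩ Finset.Ico a (a + k * s)).filter
      (fun x => z - x ∈ Y ∩ Finset.Ico b (b + k * r))).card) (t : ℕ) :
    ∃ X' ⊆ X, ∃ Y' ⊆ Y, X'.card ≤ t * k ∧ Y'.card ≤ t * r ∧
      (q + 1) ^ t * (M \ (X' + Y')).card ≤ q ^ t * M.card := by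
  induction t with
  | zero => exact ⟨∅, by simp, ∅, by simp, by simp, by simp, by simp⟩
  | succ t ih =>
    obtain ⟨X1, hX1, Y1, hY1, c1, c2, hm⟩ := ih
    have hg : ∃ g : ℕ, (∀ z ∈ M, g ≤ ((X ∩ Finset.Ico a (a + k * s)).filter
      (fun x => z - x ∈ Y ∩ Finset.Ico b (b + k * r))).card) ∧ k * s ≤ (q + 1) * g := by
      by_cases hM : M.Nonempty
      · obtain ⟨z0, hz0, hmin⟩ := Finset.exists_min_image M (fun z => ((X ∩ Finset.Ico a (a + k * s)).filter
          (fun x => z - x ∈ Y ∩ Finset.Ico b (b + k * r))).card) hM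
        exact ⟨_, hmin, h z0 hz0⟩
      · refine ⟨k * s, ?_, by nlinarith [Nat.zero_le (q * (k * s))]⟩
        intro z hz
        exact absurd ⟨z, hz⟩ hM
    obtain ⟨g, hg1, hg2⟩ := hg
    obtain ⟨X2, hX2, Y2, hY2, c3, c4, hm2⟩ := step_lem X Y (M \ (X1 + Y1)) a b k s r g hk hs
      (fun z hz => hg1 z (Finset.mem_sdiff.1 hz).1)
    refine ⟨X1 ∪ X2, Finset.union_subset hX1 hX2, Y1 ∪ Y2, Finset.union_subset hY1 hY2, ?_, ?_, ?_⟩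
    · refine (Finset.card_union_le _ _).trans ?_; linarith
    · refine (Finset.card_union_le _ _).trans ?_; linarith
    · have hsub : M \ (X1 ∪ X2 + (Y1 ∪ Y2)) ⊆ (M \ (X1 + Y1)) \ (X2 + Y2) := by
        intro z hz
        simp only [Finset.mem_sdiff] at *
        refine ⟨⟨hz.1, fun h' => hz.2 ?_⟩, fun h' => hz.2 ?_⟩
        · exact Finset.add_subset_add Finset.subset_union_left Finset.subset_union_left h'
        · exact Finset.add_subset_add Finset.subset_union_right Finset.subset_union_right h'
      have hc := Finset.card_le_card hsub
      set u := ((M \ (X1 + Y1)) \ (X2 + Y2)).card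
      set v := (M \ (X1 + Y1)).card
      have hks : 0 < k * s := Nat.mul_pos hk hs
      have h1 : (q + 1) * u ≤ q * v := by
        have : (k * s) * ((q + 1) * u) ≤ (k * s) * (q * v) := by
          have h2 := Nat.mul_le_mul_left (q + 1) hm2
          have h3 := Nat.mul_le_mul_right v hg2
          nlinarith
        exact Nat.le_of_mul_le_mul_left this hks
      calc (q + 1) ^ (t + 1) * _ ≤ (q + 1) ^ (t + 1) * u := Nat.mul_le_mul_left _ hc
        _ = (q + 1) ^ t * ((q + 1) * u) := by ring
        _ ≤ (q + 1) ^ t * (q * v) := Nat.mul_le_mul_left _ h1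
        _ = q * ((q + 1) ^ t * v) := by ring
        _ ≤ q * (q ^ t * M.card) := Nat.mul_le_mul_left _ hm
        _ = _ := by ring

lemma exists_t (q E : ℕ) : ∃ t : ℕ, E * q ^ t ≤ (q + 1) ^ t := by
  by_cases hE : E = 0
  · exact ⟨0, by simp [hE]⟩
  have hEp : (0 : ℝ) < E := by exact_mod_cast Nat.pos_of_ne_zero hE
  obtain ⟨t, ht⟩ := exists_pow_lt_of_lt_one (x := (1 : ℝ) / E) (y := (q : ℝ) / (q + 1)) (by positivity)
    (by rw [div_lt_one (by positivity)]; linarith)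
  refine ⟨t, ?_⟩
  rw [div_pow, div_lt_div_iff₀ (by positivity) hEp] at ht
  have : (E * q ^ t : ℝ) ≤ (q + 1) ^ t := by nlinarith
  exact_mod_cast this

lemma iterE_lem (q E : ℕ) : ∃ t : ℕ, ∀ (X Y M : Finset ℤ) (a b : ℤ) (k s r : ℕ), 0 < k → 0 < s →
    (∀ z ∈ M, k * s ≤ (q + 1) * ((X ∩ Finset.Ico a (a + k * s)).filter
      (fun x => z - x ∈ Y ∩ Finset.Ico b (b + k * r))).card) →
    ∃ X' ⊆ X, ∃ Y' ⊆ Y, X'.card ≤ t * k ∧ Y'.card ≤ t * r ∧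
      E * (M \ (X' + Y')).card ≤ M.card := by
  obtain ⟨t, ht⟩ := exists_t q E
  refine ⟨t, ?_⟩
  intro X Y M a b k s r hk hs h
  obtain ⟨X', hX', Y', hY', c1, c2, hm⟩ := iter_lem X Y M a b k s r q hk hs h t
  refine ⟨X', hX', Y', hY', c1, c2, ?_⟩
  have hp : 0 < (q + 1) ^ t := by positivity
  apply Nat.le_of_mul_le_mul_left _ hp
  calc (q + 1) ^ t * (E * (M \ (X' + Y')).card) = E * ((q + 1) ^ t * (M \ (X' + Y')).card) := by ring
    _ ≤ E * (q ^ t * M.card) := Nat.mul_le_mul_left _ hm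
    _ = (E * q ^ t) * M.card := by ring
    _ ≤ _ := Nat.mul_le_mul_right _ ht

lemma sdiff_union_add (M X1 X2 Y1 Y2 : Finset ℤ) :
    M \ (X1 ∪ X2 + (Y1 ∪ Y2)) ⊆ (M \ (X1 + Y1)) \ (X2 + Y2) := by
  intro z hz
  simp only [Finset.mem_sdiff] at *
  refine ⟨⟨hz.1, fun h' => hz.2 ?_⟩, fun h' => hz.2 ?_⟩
  · exact Finset.add_subset_add Finset.subset_union_left Finset.subset_union_left h'
  · exact Finset.add_subset_add Finset.subset_union_right Finset.subset_union_right h'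

lemma sdiff_anti (M X1 X2 Y1 Y2 : Finset ℤ) (hX : X1 ⊆ X2) (hY : Y1 ⊆ Y2) :
    (M \ (X2 + Y2)).card ≤ (M \ (X1 + Y1)).card :=
  Finset.card_le_card (Finset.sdiff_subset_sdiff (Finset.Subset.refl _) (Finset.add_subset_add hX hY))

lemma shell_lem (q E : ℕ) : ∃ t : ℕ, ∀ (X Y M : Finset ℤ) (a b a2 b2 : ℤ) (k s s2 r2 : ℕ),
    0 < k → 0 < s → 0 < s2 →
    M ⊆ Finset.Ico (a + b + k * s) (a + b + 2 * (k * s)) →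
    (∀ z ∈ M, k * s2 ≤ (q + 1) * ((X ∩ Finset.Ico a2 (a2 + k * s2)).filter
      (fun x => z - x ∈ Y ∩ Finset.Ico b2 (b2 + k * r2))).card) →
    ∃ X' ⊆ X, ∃ Y' ⊆ Y, X'.card ≤ (t + 1) * k ∧ Y'.card ≤ t * r2 + 2 * s ∧
      E * (M \ (X' + Y')).card ≤ ho X a (a + k * s) + ho Y b (b + 2 * (k * s)) := by
  obtain ⟨t, ht⟩ := iterE_lem q E
  refine ⟨t, ?_⟩
  intro X Y M a b a2 b2 k s s2 r2 hk hs hs2 hM h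
  have hks : 0 < k * s := Nat.mul_pos hk hs
  set H := ho X a (a + k * s) + ho Y b (b + 2 * (k * s)) with hH
  obtain ⟨X1, hX1, Y1, hY1, c1, c2, hm⟩ := step_lem X Y M a b k s (2 * s) (k * s - H) hk hs (by
    intro z hz
    have hz' := Finset.mem_Ico.1 (hM hz)
    have h1 := reps_lem X (Y ∩ Finset.Ico b (b + k * (2 * s : ℕ))) z a (a + k * s) (by
      have : (0:ℤ) ≤ k * s := by positivity
      omega)
    have h2 : ho (Y ∩ Finset.Ico b (b + k * (2 * s : ℕ))) (z - (a + k * s) + 1) (z - a + 1)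
        ≤ ho Y b (b + 2 * (k * s)) := by
      apply Finset.card_le_card
      intro y hy
      simp only [Finset.mem_sdiff, Finset.mem_Ico, Finset.mem_inter, not_and] at hy ⊢
      have e : (k : ℤ) * ((2 * s : ℕ) : ℤ) = 2 * (k * s) := by push_cast; ring
      rw [e] at hy
      refine ⟨⟨by omega, by omega⟩, fun hyY => ?_⟩
      exact absurd (hy.2 hyY (by omega)) (by omega)
    have e : ((k * s : ℕ) : ℤ) = (k : ℤ) * s := by push_cast; ring
    omega)
  have hM1 : (M \ (X1 + Y1)).card ≤ H := by
    have hMc : M.card ≤ k * s := by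
      have := Finset.card_le_card hM
      rw [Int.card_Ico] at this
      have e : ((k * s : ℕ) : ℤ) = (k : ℤ) * s := by push_cast; ring
      omega
    by_cases hc : k * s ≤ H
    · exact (Finset.card_le_card Finset.sdiff_subset).trans (hMc.trans hc)
    · push Not at hc
      obtain ⟨d, hd⟩ : ∃ d, k * s = H + d := ⟨k * s - H, by omega⟩
      have e : k * s - H = d := by omega
      rw [e, hd] at hm
      rw [hd] at hMc hks
      have : (M \ (X1 + Y1)).card * (H + d) ≤ H * (H + d) := by nlinarith
      exact Nat.le_of_mul_le_mul_right this hks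
  obtain ⟨X2, hX2, Y2, hY2, c3, c4, hm2⟩ := ht X Y (M \ (X1 + Y1)) a2 b2 k s2 r2 hk hs2
    (fun z hz => h z (Finset.mem_sdiff.1 hz).1)
  refine ⟨X1 ∪ X2, Finset.union_subset hX1 hX2, Y1 ∪ Y2, Finset.union_subset hY1 hY2, ?_, ?_, ?_⟩
  · refine (Finset.card_union_le _ _).trans ?_; linarith
  · refine (Finset.card_union_le _ _).trans ?_; linarith
  · have hc := Finset.card_le_card (sdiff_union_add M X1 X2 Y1 Y2)
    exact (Nat.mul_le_mul_left E hc).trans (hm2.trans hM1)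

lemma union_cover (X Y : Finset ℤ) (M : ℕ → Finset ℤ) (n p r E h : ℕ)
    (H : ∀ i < n, ∃ X' ⊆ X, ∃ Y' ⊆ Y, X'.card ≤ p ∧ Y'.card ≤ r ∧ E * (M i \ (X' + Y')).card ≤ h) :
    ∃ X' ⊆ X, ∃ Y' ⊆ Y, X'.card ≤ n * p ∧ Y'.card ≤ n * r ∧
      E * (((Finset.range n).biUnion M) \ (X' + Y')).card ≤ n * h := by
  induction n with
  | zero => exact ⟨∅, by simp, ∅, by simp, by simp, by simp, by simp⟩
  | succ n ih =>
    obtain ⟨X1, hX1, Y1, hY1, c1, c2, hm⟩ := ih (fun i hi => H i (by omega))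
    obtain ⟨X2, hX2, Y2, hY2, c3, c4, hm2⟩ := H n (by omega)
    refine ⟨X1 ∪ X2, Finset.union_subset hX1 hX2, Y1 ∪ Y2, Finset.union_subset hY1 hY2, ?_, ?_, ?_⟩
    · refine (Finset.card_union_le _ _).trans ?_; linarith
    · refine (Finset.card_union_le _ _).trans ?_; linarith
    · have h1 : ((Finset.range (n + 1)).biUnion M) \ (X1 ∪ X2 + (Y1 ∪ Y2)) ⊆
          (((Finset.range n).biUnion M) \ (X1 + Y1)) ∪ (M n \ (X2 + Y2)) := by
        intro z hz
        rw [Finset.range_add_one, Finset.biUnion_insert] at hz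
        have hz1 := Finset.mem_sdiff.1 hz
        have hz2 := Finset.mem_sdiff.1 (sdiff_union_add _ X1 X2 Y1 Y2 hz)
        rcases Finset.mem_union.1 hz1.1 with h | h
        · exact Finset.mem_union_right _ (Finset.mem_sdiff.2 ⟨h, hz2.2⟩)
        · exact Finset.mem_union_left _ (Finset.mem_sdiff.2 ⟨h, (Finset.mem_sdiff.1 hz2.1).2⟩)
      have h2 := (Finset.card_le_card h1).trans (Finset.card_union_le _ _)
      nlinarith

lemma base_lem : ∃ t : ℕ, ∀ (X Y : Finset ℤ) (Ts : ℤ) (T0 : ℕ), 0 ≤ Ts → (0 : ℤ) ∈ Y →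
    (∀ T : ℤ, Ts < T → T ≤ T0 → 100 * ((ho X 0 T : ℤ) + ho Y 0 T) ≤ 99 * T) →
    ∃ Y' ⊆ Y, Y'.card ≤ t + 1 ∧
      200 * (Finset.Ico Ts (T0 : ℤ) \ (X ∩ Finset.Ico 0 (T0 : ℤ) + Y')).card ≤ ho X 0 T0 + ho Y 0 T0 := by
  obtain ⟨t, ht⟩ := iterE_lem 399999 400
  refine ⟨t, ?_⟩
  intro X Y Ts T0 hTs h0 h
  set H := ho X 0 T0 + ho Y 0 T0 with hH
  set XX := X ∩ Finset.Ico 0 (T0 : ℤ) with hXX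
  set M1 := Finset.Ico Ts (T0 : ℤ) \ (XX + {0}) with hM1
  have e0 : XX + ({0} : Finset ℤ) = XX := by
    rw [show ({0} : Finset ℤ) = 0 from rfl, add_zero]
  have hM1c : M1.card ≤ H := by
    have : M1 ⊆ Finset.Ico 0 (T0 : ℤ) \ X := by
      intro z hz
      rw [hM1, e0, hXX] at hz
      simp only [Finset.mem_sdiff, Finset.mem_inter, Finset.mem_Ico, not_and] at hz ⊢
      refine ⟨⟨by omega, by omega⟩, fun hx => hz.2 hx (by omega) (by omega)⟩
    have := Finset.card_le_card this
    unfold ho at hH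
    omega
  by_cases hH0 : H = 0
  · refine ⟨{0}, by simpa using h0, by simp, ?_⟩
    change 200 * M1.card ≤ H
    omega
  set M2 := M1.filter (fun z => (H : ℤ) ≤ 400 * (z + 1)) with hM2
  obtain ⟨Y2, hY2, X2, hX2, c3, c4, hm2⟩ := ht Y XX M2 0 0 1 (10 * H) T0 (by omega) (by omega) (by
    intro z hz
    have hz1 := (Finset.mem_filter.1 hz)
    have hz2 := Finset.mem_Ico.1 (Finset.mem_sdiff.1 hz1.1).1
    have hz3 := hz1.2
    push_cast
    have key : ∀ c : ℤ, 0 ≤ c → c ≤ z + 1 → c ≤ 10 * H → c ≤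
        ((Y ∩ Finset.Ico (0:ℤ) (0 + 1 * (10 * H))).filter
          (fun x => z - x ∈ XX ∩ Finset.Ico (0:ℤ) (0 + 1 * T0))).card + (ho Y 0 c : ℤ) + ho X (z - c + 1) (z + 1) := by
      intro c hc1 hc2 hc3
      have h1 := reps_lem Y XX z 0 c hc1
      have h2 : ho XX (z - c + 1) (z - 0 + 1) ≤ ho X (z - c + 1) (z + 1) := by
        apply Finset.card_le_card
        intro y hy
        simp only [hXX, Finset.mem_sdiff, Finset.mem_Ico, Finset.mem_inter, not_and] at hy ⊢
        refine ⟨⟨by omega, by omega⟩, fun hyY => ?_⟩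
        exact absurd (hy.2 hyY (by omega)) (by omega)
      have h3 : ((Y ∩ Finset.Ico 0 c).filter (fun x => z - x ∈ XX)).card ≤ ((Y ∩ Finset.Ico (0:ℤ) (0 + 1 * (10 * H))).filter
          (fun x => z - x ∈ XX ∩ Finset.Ico (0:ℤ) (0 + 1 * T0))).card := by
        apply Finset.card_le_card
        intro y hy
        simp only [hXX, Finset.mem_filter, Finset.mem_Ico, Finset.mem_inter] at hy ⊢
        refine ⟨⟨hy.1.1, by omega, by omega⟩, ⟨hy.2, by omega, by omega⟩⟩
      omega
    by_cases hc : 10 * (H : ℤ) ≤ z + 1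
    · have k1 := key (10 * H) (by omega) hc le_rfl
      have k2 := ho_mono Y (a := 0) (b := 10 * H) (a' := 0) (b' := T0) le_rfl (by omega)
      have k3 := ho_mono X (a := z - 10 * H + 1) (b := z + 1) (a' := 0) (b' := T0) (by omega) (by omega)
      omega
    · have k1 := key (z + 1) (by omega) le_rfl (by omega)
      have k2 := h (z + 1) (by omega) (by omega)
      have e : z - (z + 1) + 1 = 0 := by ring
      rw [e] at k1
      omega)
  refine ⟨{0} ∪ Y2, Finset.union_subset (by simpa using h0) hY2, ?_, ?_⟩
  · refine (Finset.card_union_le _ _).trans ?_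
    simp; omega
  · have s1 : Finset.Ico Ts (T0 : ℤ) \ (XX + ({0} ∪ Y2)) ⊆
        (M2 \ (Y2 + X2)) ∪ (Finset.Ico 0 ((H / 400 : ℕ) : ℤ)) := by
      intro z hz
      have hz0 := Finset.mem_sdiff.1 hz
      have hz1 : z ∈ M1 := by
        rw [hM1]
        exact Finset.mem_sdiff.2 ⟨hz0.1, fun hh => hz0.2 (Finset.add_subset_add (Finset.Subset.refl _) Finset.subset_union_left hh)⟩
      have hz2 := Finset.mem_Ico.1 hz0.1
      by_cases hc : (H : ℤ) ≤ 400 * (z + 1)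
      · apply Finset.mem_union_left
        refine Finset.mem_sdiff.2 ⟨Finset.mem_filter.2 ⟨hz1, hc⟩, fun hh => hz0.2 ?_⟩
        rw [add_comm] at hh
        exact Finset.add_subset_add hX2 Finset.subset_union_right hh
      · apply Finset.mem_union_right
        rw [Finset.mem_Ico]
        omega
    have s2 := (Finset.card_le_card s1).trans (Finset.card_union_le _ _)
    rw [Int.card_Ico] at s2
    have s3 : M2.card ≤ M1.card := Finset.card_le_card (Finset.filter_subset _ _)
    omega

set_option maxHeartbeats 1000000 in
lemma beyond_lem : ∃ C : ℕ, ∀ (J : ℕ) (X Y : Finset ℤ) (Ts : ℤ) (τ : ℕ), 0 ≤ Ts → 0 < τ → (0 : ℤ) ∈ Y →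
    (∀ T : ℤ, Ts < T → T ≤ ((4 * (τ * 4 ^ J) : ℕ) : ℤ) → 100 * ((ho X 0 T : ℤ) + ho Y 0 T) ≤ 99 * T) →
    ∃ X' ⊆ X, ∃ Y' ⊆ Y, X'.card ≤ C * (τ * 2 ^ J) ∧ Y'.card ≤ C * 2 ^ J ∧
      200 * (Finset.Ico Ts ((4 * (τ * 4 ^ J) : ℕ) : ℤ) \ (X' + Y')).card ≤
        ho X 0 ((4 * (τ * 4 ^ J) : ℕ) : ℤ) + ho Y 0 ((4 * (τ * 4 ^ J) : ℕ) : ℤ)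
        + (ho X 0 ((τ * 4 ^ J : ℕ) : ℤ) + ho Y 0 ((τ * 4 ^ J : ℕ) : ℤ)) := by
  obtain ⟨t0, ht0⟩ := base_lem
  obtain ⟨t, ht⟩ := shell_lem 399 2400
  refine ⟨t0 + 5 + 12 * (16 * t + 2), ?_⟩
  intro J
  induction J with
  | zero =>
    intro X Y Ts τ hTs hτ h0 h
    obtain ⟨Y', hY', c, hm⟩ := ht0 X Y Ts (4 * (τ * 4 ^ 0)) hTs h0 h
    refine ⟨_, Finset.inter_subset_left, Y', hY', ?_, ?_, hm.trans (Nat.le_add_right _ _)⟩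
    · refine (Finset.card_le_card Finset.inter_subset_right).trans ?_
      rw [Int.card_Ico]
      push_cast
      have : (4 * (τ * 1 : ℤ) - 0).toNat = 4 * τ := by simp; omega
      rw [this]
      nlinarith
    · simp; omega
  | succ J ih =>
    intro X Y Ts τ hTs hτ h0 h
    obtain ⟨W, hW⟩ : ∃ W, W = τ * 4 ^ J := ⟨_, rfl⟩
    have hWs : τ * 4 ^ (J + 1) = 4 * W := by rw [hW]; ring
    rw [hWs] at h ⊢
    have ih' := ih X Y Ts τ hTs hτ h0
    rw [← hW] at ih'
    obtain ⟨X1, hX1, Y1, hY1, c1, c2, hm1⟩ := ih' (fun T hT1 hT2 => h T hT1 (by push_cast at *; omega))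
    obtain ⟨k, hk⟩ : ∃ k, k = τ * 2 ^ J := ⟨_, rfl⟩
    obtain ⟨s, hs⟩ : ∃ s, s = 2 ^ J := ⟨_, rfl⟩
    have hks : k * s = W := by
      rw [hk, hs, hW, show (4 : ℕ) = 2 * 2 from rfl, mul_pow]; ring
    have hs0 : 0 < s := by rw [hs]; positivity
    have hk0 : 0 < k := by rw [hk]; positivity
    have hksz : (k : ℤ) * s = W := by exact_mod_cast hks
    have hks16 : (k : ℤ) * ((16 * s : ℕ) : ℤ) = 16 * W := by push_cast; linarith
    have hks16n : k * (16 * s) = 16 * W := by linarith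
    rw [← hk] at c1
    rw [← hs] at c2
    obtain ⟨X2, hX2, Y2, hY2, c3, c4, hm2⟩ := union_cover X Y
      (fun i => (Finset.Ico (((4 + i) * W : ℕ) : ℤ) (((5 + i) * W : ℕ) : ℤ)).filter (fun z => Ts ≤ z)) 12 ((t + 1) * k)
      (t * (16 * s) + 2 * s) 2400 (ho X W (16 * W) + ho Y W (16 * W)) (by
        intro i hi
        obtain ⟨X', hX', Y', hY', d1, d2, d3⟩ := ht X Y
          ((Finset.Ico (((4 + i) * W : ℕ) : ℤ) (((5 + i) * W : ℕ) : ℤ)).filter (fun z => Ts ≤ z)) W (((2 + i) * W : ℕ) : ℤ) 0 0 k s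
          (16 * s) (16 * s) hk0 hs0 (by omega) (by
            intro z hz
            rw [hksz]
            simp only [Finset.mem_filter, Finset.mem_Ico] at hz ⊢
            push_cast at *
            constructor <;> nlinarith) (by
            intro z hz
            rw [hks16, hks16n]
            simp only [Finset.mem_filter, Finset.mem_Ico] at hz
            have hz1 : 4 * (W : ℤ) ≤ z := by push_cast at hz; nlinarith
            have hz2 : z + 1 ≤ 16 * (W : ℤ) := by
              have : (i : ℤ) ≤ 11 := by omega
              push_cast at hz; nlinarith
            have k1 := reps_lem X Y z 0 (z + 1) (by omega)
            have k2 := h (z + 1) (by omega) (by push_cast; omega)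
            have h3 : ((X ∩ Finset.Ico 0 (z + 1)).filter (fun x => z - x ∈ Y)).card ≤
                ((X ∩ Finset.Ico (0:ℤ) (0 + 16 * W)).filter
                (fun x => z - x ∈ Y ∩ Finset.Ico (0:ℤ) (0 + 16 * W))).card := by
              apply Finset.card_le_card
              intro y hy
              simp only [Finset.mem_filter, Finset.mem_Ico, Finset.mem_inter] at hy ⊢
              refine ⟨⟨hy.1.1, by omega, by omega⟩, ⟨hy.2, by omega, by omega⟩⟩
            have e : z - (z + 1) + 1 = 0 := by ring
            have e' : z - 0 + 1 = z + 1 := by ring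
            rw [e, e'] at k1
            omega)
        refine ⟨X', hX', Y', hY', d1, d2, d3.trans ?_⟩
        rw [hksz]
        apply Nat.add_le_add
        · apply ho_mono <;> omega
        · have : (i : ℤ) ≤ 11 := by omega
          have hW0 : (0:ℤ) ≤ W := by positivity
          have hiW : (i : ℤ) * W ≤ 11 * W := mul_le_mul_of_nonneg_right this hW0
          have hiW0 : 0 ≤ (i : ℤ) * W := by positivity
          have e : (((2 + i) * W : ℕ) : ℤ) = 2 * W + i * W := by push_cast; ring
          rw [e]
          apply ho_mono
          · linarith
          · linarith)
    refine ⟨X1 ∪ X2, Finset.union_subset hX1 hX2, Y1 ∪ Y2, Finset.union_subset hY1 hY2, ?_, ?_, ?_⟩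
    · refine (Finset.card_union_le _ _).trans ?_
      have : τ * 2 ^ (J + 1) = 2 * k := by rw [hk]; ring
      rw [this]
      clear * - c1 c3
      nlinarith [Nat.zero_le (t * k), Nat.zero_le (t0 * k)]
    · refine (Finset.card_union_le _ _).trans ?_
      have : 2 ^ (J + 1) = 2 * s := by rw [hs]; ring
      rw [this]
      clear * - c2 c4
      nlinarith [Nat.zero_le (t * s), Nat.zero_le (t0 * s)]
    · have hsub : Finset.Ico Ts ((4 * (4 * W) : ℕ) : ℤ) \ (X1 ∪ X2 + (Y1 ∪ Y2)) ⊆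
          (Finset.Ico Ts ((4 * W : ℕ) : ℤ) \ (X1 + Y1)) ∪ (((Finset.range 12).biUnion
          (fun i => (Finset.Ico (((4 + i) * W : ℕ) : ℤ) (((5 + i) * W : ℕ) : ℤ)).filter (fun z => Ts ≤ z))) \ (X2 + Y2)) := by
        intro z hz
        have hz1 := Finset.mem_sdiff.1 (sdiff_union_add _ X1 X2 Y1 Y2 hz)
        have hz2 := Finset.mem_sdiff.1 hz1.1
        have hz3 := Finset.mem_Ico.1 hz2.1
        by_cases hc : z < ((4 * W : ℕ) : ℤ)
        · exact Finset.mem_union_left _ (Finset.mem_sdiff.2 ⟨Finset.mem_Ico.2 ⟨hz3.1, hc⟩, hz2.2⟩)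
        · apply Finset.mem_union_right
          refine Finset.mem_sdiff.2 ⟨?_, hz1.2⟩
          have hWp : 0 < (W : ℤ) := by
            have : 0 < W := by rw [← hks]; positivity
            exact_mod_cast this
          push_cast at hc hz3
          have e1 := Int.mul_ediv_add_emod (z - 4 * W) W
          have e2 := Int.emod_nonneg (z - 4 * W) hWp.ne'
          have e3 := Int.emod_lt_of_pos (z - 4 * W) hWp
          have d0 : 0 ≤ (z - 4 * W) / W := Int.ediv_nonneg (by omega) (by omega)
          have d1 : (z - 4 * W) / W < 12 := by
            apply Int.ediv_lt_of_lt_mul hWp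
            omega
          obtain ⟨i, hi⟩ : ∃ i : ℕ, (i : ℤ) = (z - 4 * W) / W := ⟨((z - 4 * W) / W).toNat, by omega⟩
          rw [← hi] at e1 d1
          rw [Finset.mem_biUnion]
          refine ⟨i, Finset.mem_range.2 (by omega), ?_⟩
          simp only [Finset.mem_filter, Finset.mem_Ico]
          push_cast
          refine ⟨⟨by nlinarith, by nlinarith⟩, hz3.1⟩
      have s2 := (Finset.card_le_card hsub).trans (Finset.card_union_le _ _)
      have a1 := ho_add X (a := 0) (b := W) (c := 16 * W) (by omega) (by omega)
      have a2 := ho_add Y (a := 0) (b := W) (c := 16 * W) (by omega) (by omega)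
      have e16 : ((4 * (4 * W) : ℕ) : ℤ) = 16 * W := by push_cast; ring
      rw [e16] at s2 ⊢
      omega

lemma greedy_lem (F G : Finset ℤ) (l : ℕ) :
    ∃ G' ⊆ G, G'.card ≤ l ∧ min G.card (F.card * l) ≤ 2 * (F + G').card := by
  induction l with
  | zero => exact ⟨∅, by simp, by simp, by simp⟩
  | succ l ih =>
    obtain ⟨G', hG', c, hm⟩ := ih
    by_cases hc : G.card ≤ 2 * (F + G').card
    · exact ⟨G', hG', by omega, by omega⟩
    push Not at hc
    have hm' : F.card * l ≤ 2 * (F + G').card := by omega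
    obtain ⟨g, hg, hgc⟩ := avg_lem G (Finset.card_pos.1 (by omega)) F (fun g f => f + g ∉ F + G')
      (G.card - (F + G').card) (by
        intro f hf
        have h1 := Finset.card_filter_add_card_filter_not (s := G) (fun g => f + g ∈ F + G')
        have h2 : (G.filter (fun g => f + g ∈ F + G')).card ≤ (F + G').card := by
          apply Finset.card_le_card_of_injOn (fun g => f + g)
          · intro g hg
            simp only [Finset.coe_filter, Set.mem_ofPred_eq] at hg
            exact hg.2
          · intro x _ y _ h
            simpa using h
        have h3 : (G.filter (fun g => ¬ f + g ∈ F + G')).card = (G.filter (fun g => f + g ∉ F + G')).card := rfl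
        have h4 : G.card - (F + G').card ≤ (G.filter (fun g => ¬ f + g ∈ F + G')).card := by omega
        convert h4)
    refine ⟨insert g G', Finset.insert_subset hg hG', (Finset.card_insert_le _ _).trans (by omega), ?_⟩
    set S := F + G' with hS
    have hb : (F.filter (fun f => f + g ∈ S)).card * G.card + (G.card - S.card) * F.card ≤ G.card * F.card := by
      refine le_trans (le_of_eq ?_) hgc
      congr 3
      ext f
      simp
    have hnew : S.card + (F.filter (fun f => ¬ f + g ∈ S)).card ≤ (F + insert g G').card := by
      rw [← Finset.card_image_of_injective (F.filter (fun f => ¬ f + g ∈ S)) (add_left_injective g),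
        ← Finset.card_union_of_disjoint]
      · apply Finset.card_le_card
        apply Finset.union_subset
        · exact Finset.add_subset_add (Finset.Subset.refl _) (Finset.subset_insert _ _)
        · intro z hz
          obtain ⟨f, hf, rfl⟩ := Finset.mem_image.1 hz
          exact Finset.add_mem_add (Finset.mem_filter.1 hf).1 (Finset.mem_insert_self _ _)
      · rw [Finset.disjoint_right]
        intro z hz
        obtain ⟨f, hf, rfl⟩ := Finset.mem_image.1 hz
        exact (Finset.mem_filter.1 hf).2
    have hsplit := Finset.card_filter_add_card_filter_not (s := F) (fun f => f + g ∈ S)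
    obtain ⟨d, hd⟩ : ∃ d, G.card = S.card + d := ⟨G.card - S.card, by omega⟩
    have e : G.card - S.card = d := by omega
    rw [e, hd] at hb
    have hlt : S.card < d := by omega
    have hbad : 2 * (F.filter (fun f => f + g ∈ S)).card ≤ F.card := by
      by_contra hcon
      push Not at hcon
      nlinarith
    have : F.card * (l + 1) ≤ 2 * (F + insert g G').card := by
      rw [mul_add, mul_one]; omega
    exact (min_le_right _ _).trans this

lemma greedy' (F0 G : Finset ℤ) (k l : ℕ) (h1 : G.card ≤ k * l) (h2 : G.card ≤ F0.card * l) :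
    ∃ F' ⊆ F0, ∃ G' ⊆ G, F'.card ≤ k ∧ G'.card ≤ l ∧ G.card ≤ 2 * (F' + G').card := by
  obtain ⟨F', hF', hc⟩ := Finset.exists_subset_card_eq (s := F0) (n := min k F0.card) (min_le_right _ _)
  obtain ⟨G', hG', c, hm⟩ := greedy_lem F' G l
  refine ⟨F', hF', G', hG', by omega, c, ?_⟩
  have : G.card ≤ F'.card * l := by
    rw [hc]
    rcases le_total k F0.card with h | h
    · rw [min_eq_left h]; exact h1
    · rw [min_eq_right h]; exact h2
  omega

def PreX (X : Finset ℤ) (A F : ℤ) : Prop := ∀ t : ℤ, 0 ≤ t → t ≤ F → t ≤ 100 * (X ∩ Finset.Ico A (A + t)).card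
def SufX (X : Finset ℤ) (A : ℤ) : Prop := ∀ a : ℤ, 0 ≤ a → a ≤ A → 100 * ((X ∩ Finset.Ico a A).card : ℤ) ≤ A - a

lemma gain1 (X Y : Finset ℤ) (A B Ts F : ℤ) (k l : ℕ) (hA : 0 ≤ A) (hB : 0 ≤ B)
    (hpX : PreX X A F)
    (hTs0 : 0 ≤ Ts)
    (hT : 99 * Ts ≤ 100 * ((ho X A (A + Ts) : ℤ) + ho Y B (B + Ts))) (hTsF : Ts ≤ F)
    (hl : 10000 ≤ l) (hkl : F ≤ k * l)
    (hax : 10 * ((X ∩ Finset.Ico 0 A).card : ℤ) ≤ Ts) (hay : 10 * ((Y ∩ Finset.Ico 0 B).card : ℤ) ≤ Ts)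
    (hY : Ts ≤ 2 * ((Y ∩ Finset.Ico B (B + Ts)).card : ℤ)) :
    ∃ X' ⊆ X, ∃ Y' ⊆ Y, X'.card ≤ k ∧ Y'.card ≤ l ∧
      100 * (((X ∩ Finset.Ico 0 A).card : ℤ) + (Y ∩ Finset.Ico 0 B).card + Ts) ≤
        100 * ((X' + Y') ∩ Finset.Ico 0 (A + B + Ts)).card + 49 * ((ho X A (A + Ts) : ℤ) + ho Y B (B + Ts))
        + 50 * ((ho X A (A + F) : ℤ) + ho Y B (B + F)) := by
  have m1 := ho_mono X (a := A) (b := A + Ts) (a' := A) (b' := A + F) le_rfl (by omega)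
  have m2 := ho_mono Y (a := B) (b := B + Ts) (a' := B) (b' := B + F) le_rfl (by omega)
  obtain ⟨τ, hτ⟩ : ∃ τ : ℤ, τ = (Ts + 99) / 100 := ⟨_, rfl⟩
  by_cases hz : Ts = 0
  · exact ⟨∅, by simp, ∅, by simp, by simp, by simp, by omega⟩
  have hF0 := hpX τ (by omega) (by omega)
  have c2 := ho_card Y (a := B) (b := B + Ts - τ + 1) (by omega)
  set F0 := X ∩ Finset.Ico A (A + τ) with hF0d
  set G := Y ∩ Finset.Ico B (B + Ts - τ + 1) with hGd
  have c1 := ho_card Y (a := B) (b := B + Ts) (by omega)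
  have c3 := ho_mono Y (a := B) (b := B + Ts - τ + 1) (a' := B) (b' := B + Ts) le_rfl (by omega)
  obtain ⟨F', hF', G', hG', d1, d2, d3⟩ := greedy' F0 G k l (by
      have : (G.card : ℤ) ≤ k * l := by omega
      exact_mod_cast this) (by
      have : F0.card * 10000 ≤ F0.card * l := Nat.mul_le_mul_left _ hl
      omega)
  refine ⟨F', hF'.trans Finset.inter_subset_left, G', hG'.trans Finset.inter_subset_left, d1, d2, ?_⟩
  have hsub : F' + G' ⊆ (F' + G') ∩ Finset.Ico 0 (A + B + Ts) := by
    intro z hz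
    refine Finset.mem_inter.2 ⟨hz, ?_⟩
    obtain ⟨x, hx, y, hy, rfl⟩ := Finset.mem_add.1 hz
    have hx' := hF' hx
    have hy' := hG' hy
    simp only [hF0d, hGd, Finset.mem_inter, Finset.mem_Ico] at hx' hy' ⊢
    omega
  have hcard := Finset.card_le_card hsub
  omega

lemma gain2 (X Y : Finset ℤ) (A B Ts F : ℤ) (k l : ℕ) (hA : 0 ≤ A) (hB : 0 ≤ B)
    (hsX : SufX X A) (hTs0 : 0 ≤ Ts)
    (hT : 99 * Ts ≤ 100 * ((ho X A (A + Ts) : ℤ) + ho Y B (B + Ts)))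
    (hl : 10000 ≤ l) (hkl : F ≤ k * l)
    (haF : 60 * ((X ∩ Finset.Ico 0 A).card : ℤ) ≤ F)
    (hax : Ts < 10 * ((X ∩ Finset.Ico 0 A).card : ℤ))
    (hay : (Y ∩ Finset.Ico 0 B).card ≤ (X ∩ Finset.Ico 0 A).card) :
    ∃ X' ⊆ X, ∃ Y' ⊆ Y, X'.card ≤ k ∧ Y'.card ≤ l ∧
      100 * (((X ∩ Finset.Ico 0 A).card : ℤ) + (Y ∩ Finset.Ico 0 B).card + Ts) ≤
        100 * ((X' + Y') ∩ Finset.Ico 0 (A + B + Ts)).card + 49 * ((ho X A (A + Ts) : ℤ) + ho Y B (B + Ts))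
        + 50 * ((ho X A (A + F) : ℤ) + ho Y B (B + F)) := by
  set a := (X ∩ Finset.Ico 0 A).card with ha
  have m1 := ho_mono X (a := A) (b := A + (Ts + 50 * a)) (a' := A) (b' := A + F) le_rfl (by omega)
  have m2 := ho_mono Y (a := B) (b := B + (Ts + 50 * a)) (a' := B) (b' := B + F) le_rfl (by omega)
  have n1 := ho_add X (a := A) (b := A + Ts) (c := A + (Ts + 50 * a)) (by omega) (by omega)
  have n2 := ho_add Y (a := B) (b := B + Ts) (c := B + (Ts + 50 * a)) (by omega) (by omega)
  by_cases hc : 5 * a ≤ ho X (A + Ts) (A + (Ts + 50 * a)) + ho Y (B + Ts) (B + (Ts + 50 * a))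
  · exact ⟨∅, by simp, ∅, by simp, by simp, by simp, by omega⟩
  push Not at hc
  have s0 := hsX 0 le_rfl hA
  rw [← ha] at s0
  have s1 := hsX (A - 60 * a) (by omega) (by omega)
  have p0 := ho_add X (a := 0) (b := A - 60 * a) (c := A) (by omega) (by omega)
  have p1 := ho_card X (a := 0) (b := A) (by omega)
  have p2 := ho_card X (a := 0) (b := A - 60 * a) (by omega)
  have p3 := ho_card X (a := A - 60 * a) (b := A) (by omega)
  have c2 := ho_card Y (a := B + Ts) (b := B + (Ts + 50 * a)) (by omega)
  set F0 := X ∩ Finset.Ico 0 (A - 60 * a) with hF0d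
  set G := Y ∩ Finset.Ico (B + Ts) (B + (Ts + 50 * a)) with hGd
  obtain ⟨F', hF', G', hG', d1, d2, d3⟩ := greedy' F0 G k l (by
      have : (G.card : ℤ) ≤ k * l := by omega
      exact_mod_cast this) (by
      have : F0.card * 10000 ≤ F0.card * l := Nat.mul_le_mul_left _ hl
      omega)
  refine ⟨F', hF'.trans Finset.inter_subset_left, G', hG'.trans Finset.inter_subset_left, d1, d2, ?_⟩
  have hsub : F' + G' ⊆ (F' + G') ∩ Finset.Ico 0 (A + B + Ts) := by
    intro z hz
    refine Finset.mem_inter.2 ⟨hz, ?_⟩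
    obtain ⟨x, hx, y, hy, rfl⟩ := Finset.mem_add.1 hz
    have hx' := hF' hx
    have hy' := hG' hy
    simp only [hF0d, hGd, Finset.mem_inter, Finset.mem_Ico] at hx' hy' ⊢
    omega
  have hcard := Finset.card_le_card hsub
  omega

lemma gain_lem (X Y : Finset ℤ) (A B Ts F : ℤ) (k l : ℕ) (hA : 0 ≤ A) (hB : 0 ≤ B)
    (hpX : PreX X A F) (hsX : SufX X A) (hpY : PreX Y B F) (hsY : SufX Y B)
    (hTs0 : 0 ≤ Ts)
    (hT : 99 * Ts ≤ 100 * ((ho X A (A + Ts) : ℤ) + ho Y B (B + Ts)))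
    (hT2 : ((ho X A (A + Ts) : ℤ) + ho Y B (B + Ts)) ≤ Ts) (hTsF : Ts ≤ F)
    (hk : 10000 ≤ k) (hl : 10000 ≤ l) (hkl : F ≤ k * l)
    (hax : 60 * ((X ∩ Finset.Ico 0 A).card : ℤ) ≤ F) (hay : 60 * ((Y ∩ Finset.Ico 0 B).card : ℤ) ≤ F) :
    ∃ X' ⊆ X, ∃ Y' ⊆ Y, X'.card ≤ k ∧ Y'.card ≤ l ∧
      100 * (((X ∩ Finset.Ico 0 A).card : ℤ) + (Y ∩ Finset.Ico 0 B).card + Ts) ≤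
        100 * ((X' + Y') ∩ Finset.Ico 0 (A + B + Ts)).card + 49 * ((ho X A (A + Ts) : ℤ) + ho Y B (B + Ts))
        + 50 * ((ho X A (A + F) : ℤ) + ho Y B (B + F)) := by
  have hkl' : F ≤ l * k := by linarith
  have hT' : 99 * Ts ≤ 100 * ((ho Y B (B + Ts) : ℤ) + ho X A (A + Ts)) := by omega
  have c1 := ho_card X (a := A) (b := A + Ts) (by omega)
  have c2 := ho_card Y (a := B) (b := B + Ts) (by omega)
  have eAB : B + A + Ts = A + B + Ts := by ring
  by_cases h1 : 10 * ((X ∩ Finset.Ico 0 A).card : ℤ) ≤ Ts ∧ 10 * ((Y ∩ Finset.Ico 0 B).card : ℤ) ≤ Ts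
  · by_cases h2 : Ts ≤ 2 * ((Y ∩ Finset.Ico B (B + Ts)).card : ℤ)
    · exact gain1 X Y A B Ts F k l hA hB hpX hTs0 hT hTsF hl hkl h1.1 h1.2 h2
    · obtain ⟨Y', hY', X', hX', d1, d2, d3⟩ :=
        gain1 Y X B A Ts F l k hB hA hpY hTs0 hT' hTsF hk hkl' h1.2 h1.1 (by omega)
      rw [add_comm Y' X', eAB] at d3
      exact ⟨X', hX', Y', hY', d2, d1, by linarith⟩
  · by_cases h2 : (Y ∩ Finset.Ico 0 B).card ≤ (X ∩ Finset.Ico 0 A).card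
    · exact gain2 X Y A B Ts F k l hA hB hsX hTs0 hT hl hkl hax (by omega) h2
    · obtain ⟨Y', hY', X', hX', d1, d2, d3⟩ :=
        gain2 Y X B A Ts F l k hB hA hsY hTs0 hT' hk hkl' hay (by omega) (by omega)
      rw [add_comm Y' X', eAB] at d3
      exact ⟨X', hX', Y', hY', d2, d1, by linarith⟩

lemma ho_translate (X : Finset ℤ) (A a b : ℤ) :
    ho (X.image (fun x => x - A)) a b = ho X (A + a) (A + b) := by
  unfold ho
  apply Finset.card_bij (fun x _ => A + x)
  · intro x hx
    simp only [Finset.mem_sdiff, Finset.mem_Ico, Finset.mem_image, not_exists, not_and] at hx ⊢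
    exact ⟨⟨by omega, by omega⟩, fun h => hx.2 _ h (by ring)⟩
  · intro x _ y _ h
    omega
  · intro y hy
    simp only [Finset.mem_sdiff, Finset.mem_Ico, Finset.mem_image, not_exists, not_and] at hy ⊢
    refine ⟨y - A, ⟨⟨by omega, by omega⟩, fun x hx h => hy.2 ?_⟩, by ring⟩
    have : x = y := by omega
    rwa [← this]

lemma beyond_tr : ∃ C : ℕ, ∀ (J : ℕ) (X Y : Finset ℤ) (A B Ts : ℤ) (τ N : ℕ), N = 4 * (τ * 4 ^ J) → 0 ≤ Ts → 0 < τ → B ∈ Y →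
    (∀ T : ℤ, Ts < T → T ≤ N → 100 * ((ho X A (A + T) : ℤ) + ho Y B (B + T)) ≤ 99 * T) →
    ∃ X' ⊆ X, ∃ Y' ⊆ Y, X'.card ≤ C * (τ * 2 ^ J) ∧ Y'.card ≤ C * 2 ^ J ∧
      100 * (Finset.Ico (A + B + Ts) (A + B + N) \ (X' + Y')).card ≤
        ho X A (A + N) + ho Y B (B + N) := by
  obtain ⟨C, hC⟩ := beyond_lem
  refine ⟨C, ?_⟩
  intro J X Y A B Ts τ N hN hTs hτ hB h
  obtain ⟨X1, hX1, Y1, hY1, c1, c2, hm⟩ := hC J (X.image (fun x => x - A)) (Y.image (fun x => x - B)) Ts τ hTs hτ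
    (Finset.mem_image.2 ⟨B, hB, by ring⟩) (by
      intro T hT1 hT2
      rw [ho_translate, ho_translate, add_zero, add_zero]
      exact h T hT1 (by rw [hN]; exact hT2))
  rw [← hN] at hm
  simp only [ho_translate, add_zero] at hm
  refine ⟨X1.image (fun x => x + A), ?_, Y1.image (fun x => x + B), ?_, Finset.card_image_le.trans c1,
    Finset.card_image_le.trans c2, ?_⟩
  · intro x hx
    obtain ⟨y, hy, rfl⟩ := Finset.mem_image.1 hx
    obtain ⟨z, hz, rfl⟩ := Finset.mem_image.1 (hX1 hy)
    simpa using hz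
  · intro x hx
    obtain ⟨y, hy, rfl⟩ := Finset.mem_image.1 hx
    obtain ⟨z, hz, rfl⟩ := Finset.mem_image.1 (hY1 hy)
    simpa using hz
  · have hle : (Finset.Ico (A + B + Ts) (A + B + N) \ (X1.image (fun x => x + A) + Y1.image (fun x => x + B))).card ≤
        (Finset.Ico Ts (N : ℤ) \ (X1 + Y1)).card := by
      apply Finset.card_le_card_of_injOn (fun z => z - A - B)
      · intro z hz
        simp only [Finset.coe_sdiff, Set.mem_sdiff, Finset.mem_coe, Finset.mem_Ico] at hz ⊢
        refine ⟨⟨by omega, by omega⟩, fun hh => hz.2 ?_⟩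
        obtain ⟨x, hx, y, hy, he⟩ := Finset.mem_add.1 hh
        have : z = (x + A) + (y + B) := by omega
        rw [this]
        exact Finset.add_mem_add (Finset.mem_image_of_mem _ hx) (Finset.mem_image_of_mem _ hy)
      · intro x _ y _ hxy
        simp only at hxy
        omega
    have hW : ((τ * 4 ^ J : ℕ) : ℤ) ≤ N := by
      have : τ * 4 ^ J ≤ N := by omega
      exact_mod_cast this
    have m1 := ho_mono X (a := A) (b := A + ((τ * 4 ^ J : ℕ) : ℤ)) (a' := A) (b' := A + N) le_rfl (by omega)
    have m2 := ho_mono Y (a := B) (b := B + ((τ * 4 ^ J : ℕ) : ℤ)) (a' := B) (b' := B + N) le_rfl (by omega)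
    omega

lemma argmin_lem (X : Finset ℤ) (N F : ℤ) (hN : 0 < N) (hF : 2 * F ≤ N) (hF1 : 1 ≤ F)
    (hX : 100000 * (ho X 0 N : ℤ) ≤ N) :
    ∃ A : ℤ, 0 ≤ A ∧ 90000 * A ≤ N ∧ A ∈ X ∧ PreX X A F ∧ SufX X A := by
  obtain ⟨A, hA, hmin⟩ := Finset.exists_min_image (Finset.Icc 0 N)
    (fun a => 100 * ((X ∩ Finset.Ico 0 a).card : ℤ) - a) ⟨0, by simp; omega⟩
  rw [Finset.mem_Icc] at hA
  have h0 := hmin 0 (by simp; omega)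
  simp only [Finset.Ico_self, Finset.inter_empty, Finset.card_empty] at h0
  have hcA := ho_card X hA.1
  have hmA := ho_mono X (a := 0) (b := A) (a' := 0) (b' := N) le_rfl hA.2
  have hpre : PreX X A F := by
    intro t ht1 ht2
    have h1 := hmin (A + t) (by rw [Finset.mem_Icc]; omega)
    have e1 := ho_card X (a := 0) (b := A + t) (by omega)
    have e2 := ho_card X (a := A) (b := A + t) (by omega)
    have e3 := ho_add X (a := 0) (b := A) (c := A + t) (by omega) (by omega)
    omega
  refine ⟨A, hA.1, by omega, ?_, hpre, ?_⟩
  · have h1 := hpre 1 (by omega) hF1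
    have h2 : (X ∩ Finset.Ico A (A + 1)).Nonempty := by
      rw [← Finset.card_pos]; omega
    obtain ⟨x, hx⟩ := h2
    simp only [Finset.mem_inter, Finset.mem_Ico] at hx
    have : x = A := by omega
    rw [← this]; exact hx.1
  · intro a ha1 ha2
    have h1 := hmin a (by rw [Finset.mem_Icc]; omega)
    have e1 := ho_card X (a := 0) (b := a) (by omega)
    have e2 := ho_card X (a := a) (b := A) (by omega)
    have e3 := ho_add X (a := 0) (b := a) (c := A) (by omega) (by omega)
    omega

lemma onesided : ∃ C : ℕ, ∀ (J σ P : ℕ) (X Y : Finset ℤ), 0 < σ → P = σ * 4 ^ J →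
    100000 * ho X 0 (128 * P) ≤ 64 * P → 100000 * ho Y 0 (128 * P) ≤ 64 * P →
    ∃ X' ⊆ X, ∃ Y' ⊆ Y, X'.card ≤ C * (σ * 2 ^ J) ∧ Y'.card ≤ C * 2 ^ J ∧
      100 * (Finset.Ico 0 (64 * P : ℤ) \ (X' + Y')).card ≤
        100 * (ho X 0 (8 * P) + ho Y 0 (8 * P)) + (ho X (8 * P) (128 * P) + ho Y (8 * P) (128 * P)) := by
  obtain ⟨C, hC⟩ := beyond_tr
  refine ⟨16 * C + 10000, ?_⟩
  intro J σ P X Y hσ hP hX hY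
  have hP1 : 0 < P := by rw [hP]; positivity
  have hX' := ho_mono X (a := 0) (b := 64 * P) (a' := 0) (b' := 128 * P) le_rfl (by omega)
  have hY' := ho_mono Y (a := 0) (b := 64 * P) (a' := 0) (b' := 128 * P) le_rfl (by omega)
  obtain ⟨A, hA0, hA1, hA2, hA3, hA4⟩ := argmin_lem X (64 * P) (4 * P) (by omega) (by omega) (by omega) (by omega)
  obtain ⟨B, hB0, hB1, hB2, hB3, hB4⟩ := argmin_lem Y (64 * P) (4 * P) (by omega) (by omega) (by omega) (by omega)
  obtain ⟨Ts, hTs, hTmax⟩ := Finset.exists_max_image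
    ((Finset.Icc (0 : ℤ) (64 * P)).filter (fun T => 99 * T ≤ 100 * ((ho X A (A + T) : ℤ) + ho Y B (B + T))))
    (fun T => T) ⟨0, by simp; positivity⟩
  simp only [Finset.mem_filter, Finset.mem_Icc] at hTs hTmax
  have hmaxT : ∀ T : ℤ, Ts < T → T ≤ 64 * P → 100 * ((ho X A (A + T) : ℤ) + ho Y B (B + T)) < 99 * T := by
    intro T h1 h2
    by_contra hcon
    have := hTmax T ⟨⟨by omega, h2⟩, by omega⟩
    omega
  have q1 := ho_mono X (a := A) (b := A + Ts) (a' := 0) (b' := 128 * P) hA0 (by omega)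
  have q2 := ho_mono Y (a := B) (b := B + Ts) (a' := 0) (b' := 128 * P) hB0 (by omega)
  have hTsF : Ts ≤ 4 * P := by omega
  have hHT : ((ho X A (A + Ts) : ℤ) + ho Y B (B + Ts)) ≤ Ts := by
    have h1 := hmaxT (Ts + 1) (by omega) (by omega)
    have h2 := ho_mono X (a := A) (b := A + Ts) (a' := A) (b' := A + (Ts + 1)) le_rfl (by omega)
    have h3 := ho_mono Y (a := B) (b := B + Ts) (a' := B) (b' := B + (Ts + 1)) le_rfl (by omega)
    omega
  obtain ⟨X1, hX1, Y1, hY1, c1, c2, hm1⟩ := hC J X Y A B Ts (16 * σ) (64 * P) (by rw [hP]; ring) hTs.1.1 (by omega) hB2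
    (fun T h1 h2 => (hmaxT T h1 (by push_cast at h2; exact h2)).le)
  have sA := hA4 0 le_rfl hA0
  have sB := hB4 0 le_rfl hB0
  have p2 : 1 ≤ 2 ^ J := Nat.one_le_two_pow
  obtain ⟨X2, hX2, Y2, hY2, c3, c4, hm2⟩ := gain_lem X Y A B Ts (4 * P) (10000 * (σ * 2 ^ J)) (10000 * 2 ^ J) hA0 hB0 hA3 hA4
    hB3 hB4 hTs.1.1 hTs.2 hHT hTsF (by nlinarith) (by omega) (by
      have : 4 * P ≤ (10000 * (σ * 2 ^ J)) * (10000 * 2 ^ J) := by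
        have e : P = σ * 2 ^ J * 2 ^ J := by rw [hP, show (4 : ℕ) = 2 * 2 from rfl, mul_pow]; ring
        nlinarith
      exact_mod_cast this) (by omega) (by omega)
  refine ⟨X1 ∪ X2, Finset.union_subset hX1 hX2, Y1 ∪ Y2, Finset.union_subset hY1 hY2, ?_, ?_, ?_⟩
  · refine (Finset.card_union_le _ _).trans ?_
    clear * - c1 c3
    nlinarith
  · refine (Finset.card_union_le _ _).trans ?_
    clear * - c2 c4
    nlinarith [Nat.zero_le (C * 2 ^ J)]
  · have hsub : Finset.Ico 0 (64 * P : ℤ) \ (X1 ∪ X2 + (Y1 ∪ Y2)) ⊆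
        (Finset.Ico (A + B + Ts) (A + B + ((64 * P : ℕ) : ℤ)) \ (X1 + Y1)) ∪
        (Finset.Ico 0 (A + B + Ts) \ (X2 + Y2)) := by
      intro z hz
      have hz1 := Finset.mem_sdiff.1 (sdiff_union_add _ X1 X2 Y1 Y2 hz)
      have hz2 := Finset.mem_sdiff.1 hz1.1
      have hz3 := Finset.mem_Ico.1 hz2.1
      by_cases hc : z < A + B + Ts
      · exact Finset.mem_union_right _ (Finset.mem_sdiff.2 ⟨Finset.mem_Ico.2 ⟨hz3.1, hc⟩, hz1.2⟩)
      · exact Finset.mem_union_left _ (Finset.mem_sdiff.2 ⟨Finset.mem_Ico.2 ⟨by omega, by push_cast; omega⟩, hz2.2⟩)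
    have s1 := (Finset.card_le_card hsub).trans (Finset.card_union_le _ _)
    have s2 := Finset.card_inter_add_card_sdiff (Finset.Ico 0 (A + B + Ts)) (X2 + Y2)
    rw [Finset.inter_comm, Int.card_Ico] at s2
    have a1 := ho_card X hA0
    have a2 := ho_card Y hB0
    have b1 := ho_mono X (a := A) (b := A + Ts) (a' := A) (b' := A + 4 * P) le_rfl (by omega)
    have b2 := ho_mono Y (a := B) (b := B + Ts) (a' := B) (b' := B + 4 * P) le_rfl (by omega)
    have b3 := ho_mono X (a := A) (b := A + 4 * P) (a' := A) (b' := 8 * P) le_rfl (by omega)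
    have b4 := ho_mono Y (a := B) (b := B + 4 * P) (a' := B) (b' := 8 * P) le_rfl (by omega)
    have d1 := ho_add X (a := 0) (b := A) (c := 8 * P) (by omega) (by omega)
    have d2 := ho_add Y (a := 0) (b := B) (c := 8 * P) (by omega) (by omega)
    have d3 := ho_add X (a := A) (b := 8 * P) (c := 128 * P) (by omega) (by omega)
    have d4 := ho_add Y (a := B) (b := 8 * P) (c := 128 * P) (by omega) (by omega)
    have d5 := ho_mono X (a := A) (b := A + ((64 * P : ℕ) : ℤ)) (a' := A) (b' := 128 * P) le_rfl (by push_cast; omega)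
    have d6 := ho_mono Y (a := B) (b := B + ((64 * P : ℕ) : ℤ)) (a' := B) (b' := 128 * P) le_rfl (by push_cast; omega)
    clear hX' hY' hTmax hmaxT
    omega

lemma middle (L : ℕ) : ∃ C : ℕ, ∀ (J σ P : ℕ) (X Y : Finset ℤ) (m n : ℤ), 0 < σ → P = σ * 4 ^ J →
    256 * (P : ℤ) ≤ m → 256 * (P : ℤ) ≤ n → m ≤ L * P → n ≤ L * P →
    100000 * ho X 0 m ≤ 64 * P → 100000 * ho Y 0 n ≤ 64 * P →
    ∃ X' ⊆ X, ∃ Y' ⊆ Y, X'.card ≤ C * (σ * 2 ^ J) ∧ Y'.card ≤ C * 2 ^ J ∧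
      2 * (Finset.Ico (32 * P : ℤ) (m + n - 48 * P) \ (X' + Y')).card ≤
        ho X (8 * P) (m - 8 * P) + ho Y (8 * P) (n - 8 * P) := by
  obtain ⟨t, ht⟩ := shell_lem 1 (2 * (L + 1))
  refine ⟨(L + 1) * (16 * t + 16), ?_⟩
  intro J σ P X Y m n hσ hP hm hn hmL hnL hX hY
  have hP1 : 0 < P := by rw [hP]; positivity
  obtain ⟨k, hk⟩ : ∃ k, k = 16 * (σ * 2 ^ J) := ⟨_, rfl⟩
  obtain ⟨s, hs⟩ : ∃ s, s = 2 ^ J := ⟨_, rfl⟩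
  have hks : k * s = 16 * P := by
    rw [hk, hs, hP, show (4 : ℕ) = 2 * 2 from rfl, mul_pow]; ring
  have hs0 : 0 < s := by rw [hs]; positivity
  have hk0 : 0 < k := by rw [hk]; positivity
  have hksz : (k : ℤ) * s = 16 * P := by exact_mod_cast hks
  have hks2 : (k : ℤ) * ((2 * s : ℕ) : ℤ) = 32 * P := by push_cast; linarith
  obtain ⟨X2, hX2, Y2, hY2, c3, c4, hm2⟩ := union_cover X Y
    (fun i => if 16 * ((i : ℤ) * P) ≤ m + n - 80 * P then
      Finset.Ico (32 * P + 16 * ((i : ℤ) * P)) (48 * P + 16 * ((i : ℤ) * P)) else ∅) (L + 1) ((t + 1) * k)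
    (t * (2 * s) + 2 * s) (2 * (L + 1)) (ho X (8 * P) (m - 8 * P) + ho Y (8 * P) (n - 8 * P)) (by
      intro i hi
      by_cases hc : 16 * ((i : ℤ) * P) ≤ m + n - 80 * P
      · simp only [if_pos hc]
        obtain ⟨v, hv⟩ : ∃ v : ℤ, v = 16 * ((i : ℤ) * P) := ⟨_, rfl⟩
        have hv0 : 0 ≤ v := by rw [hv]; positivity
        rw [← hv] at hc ⊢
        obtain ⟨a', b', ha0, hb0, hab, ha1, hb1⟩ : ∃ a' b' : ℤ, 0 ≤ a' ∧ 0 ≤ b' ∧ a' + b' = v ∧ a' ≤ m - 32 * P ∧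
            b' ≤ n - 48 * P := by
          rcases le_total v (m - 32 * P) with h | h
          · exact ⟨v, 0, hv0, le_rfl, by omega, h, by omega⟩
          · exact ⟨m - 32 * P, v - (m - 32 * P), by omega, by omega, by omega, le_rfl, by omega⟩
        obtain ⟨X', hX', Y', hY', d1, d2, d3⟩ := ht X Y
          (Finset.Ico (32 * P + v) (48 * P + v)) (8 * P + a') (8 * P + b') (8 * P + a') (8 * P + b') k s
          s (2 * s) hk0 hs0 hs0 (by
            intro z hz
            rw [hksz]
            simp only [Finset.mem_Ico] at hz ⊢
            omega) (by
            intro z hz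
            rw [hksz, hks2, hks]
            simp only [Finset.mem_Ico] at hz
            have k1 := reps_lem X (Y ∩ Finset.Ico (8 * P + b') (8 * P + b' + 32 * P)) z (8 * P + a') (8 * P + a' + 16 * P)
              (by omega)
            have h2 : ho (Y ∩ Finset.Ico (8 * P + b') (8 * P + b' + 32 * P)) (z - (8 * P + a' + 16 * P) + 1) (z - (8 * P + a') + 1)
                ≤ ho Y 0 n := by
              apply Finset.card_le_card
              intro y hy
              simp only [Finset.mem_sdiff, Finset.mem_Ico, Finset.mem_inter, not_and] at hy ⊢
              refine ⟨⟨by omega, by omega⟩, fun hyY => ?_⟩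
              exact absurd (hy.2 hyY (by omega)) (by omega)
            have h3 := ho_mono X (a := 8 * P + a') (b := 8 * P + a' + 16 * P) (a' := 0) (b' := m) (by omega) (by omega)
            omega)
        refine ⟨X', hX', Y', hY', d1, d2, d3.trans ?_⟩
        rw [hksz]
        apply Nat.add_le_add
        · apply ho_mono <;> omega
        · apply ho_mono <;> omega
      · simp only [if_neg hc]
        exact ⟨∅, by simp, ∅, by simp, by simp, by simp, by simp⟩)
  refine ⟨X2, hX2, Y2, hY2, ?_, ?_, ?_⟩
  · rw [hk] at c3
    refine c3.trans (le_of_eq ?_)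
    ring
  · rw [← hs]
    refine c4.trans ?_
    rw [mul_assoc]
    apply Nat.mul_le_mul_left
    nlinarith [Nat.zero_le (t * s)]
  · have hsub : Finset.Ico (32 * P : ℤ) (m + n - 48 * P) ⊆ (Finset.range (L + 1)).biUnion
        (fun i => if 16 * ((i : ℤ) * P) ≤ m + n - 80 * P then
          Finset.Ico (32 * P + 16 * ((i : ℤ) * P)) (48 * P + 16 * ((i : ℤ) * P)) else ∅) := by
      intro z hz
      rw [Finset.mem_Ico] at hz
      have hWp : 0 < 16 * (P : ℤ) := by omega
      have e1 := Int.mul_ediv_add_emod (z - 32 * P) (16 * P)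
      have e2 := Int.emod_nonneg (z - 32 * P) hWp.ne'
      have e3 := Int.emod_lt_of_pos (z - 32 * P) hWp
      have d0 : 0 ≤ (z - 32 * P) / (16 * P) := Int.ediv_nonneg (by omega) (by omega)
      have d1 : (z - 32 * P) / (16 * P) < L + 1 := by
        apply Int.ediv_lt_of_lt_mul hWp
        nlinarith
      obtain ⟨i, hi⟩ : ∃ i : ℕ, (i : ℤ) = (z - 32 * P) / (16 * P) := ⟨((z - 32 * P) / (16 * P)).toNat, by omega⟩
      rw [← hi] at e1 d1
      have e4 : 16 * (P : ℤ) * i = 16 * ((i : ℤ) * P) := by ring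
      rw [e4] at e1
      rw [Finset.mem_biUnion]
      refine ⟨i, Finset.mem_range.2 (by omega), ?_⟩
      rw [if_pos (by omega), Finset.mem_Ico]
      omega
    have s2 := Finset.card_le_card (Finset.sdiff_subset_sdiff hsub (Finset.Subset.refl (X2 + Y2)))
    have s3 := Nat.mul_le_mul_left (2 * (L + 1)) s2
    have s4 := s3.trans hm2
    have e : ∀ u : ℕ, 2 * (L + 1) * u = (L + 1) * (2 * u) := fun u => by ring
    rw [e] at s4
    exact Nat.le_of_mul_le_mul_left s4 (by omega)

lemma ho_reflect (X : Finset ℤ) (m a b : ℤ) :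
    ho (X.image (fun x => m - 1 - x)) a b = ho X (m - b) (m - a) := by
  unfold ho
  apply Finset.card_bij (fun x _ => m - 1 - x)
  · intro x hx
    simp only [Finset.mem_sdiff, Finset.mem_Ico, Finset.mem_image, not_exists, not_and] at hx ⊢
    exact ⟨⟨by omega, by omega⟩, fun h => hx.2 _ h (by ring)⟩
  · intro x _ y _ h
    omega
  · intro y hy
    simp only [Finset.mem_sdiff, Finset.mem_Ico, Finset.mem_image, not_exists, not_and] at hy ⊢
    refine ⟨m - 1 - y, ⟨⟨by omega, by omega⟩, fun x hx h => hy.2 ?_⟩, by ring⟩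
    have : x = y := by omega
    rwa [← this]

lemma int_thm (L : ℕ) : ∃ C : ℕ, ∀ (J σ P : ℕ) (X Y : Finset ℤ) (m n : ℤ), 0 < σ → P = σ * 4 ^ J →
    256 * (P : ℤ) ≤ m → 256 * (P : ℤ) ≤ n → m ≤ L * P → n ≤ L * P →
    100000 * ho X 0 m ≤ 64 * P → 100000 * ho Y 0 n ≤ 64 * P →
    ∃ X' ⊆ X, ∃ Y' ⊆ Y, X'.card ≤ C * (σ * 2 ^ J) ∧ Y'.card ≤ C * 2 ^ J ∧
      (Finset.Ico 0 (m + n - 1) \ (X' + Y')).card ≤ ho X 0 m + ho Y 0 n := by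
  obtain ⟨C1, hC1⟩ := middle L
  obtain ⟨C2, hC2⟩ := onesided
  refine ⟨C1 + 2 * C2, ?_⟩
  intro J σ P X Y m n hσ hP hm hn hmL hnL hX hY
  have hP1 : 0 < P := by rw [hP]; positivity
  have lx1 := ho_mono X (a := 0) (b := 128 * P) (a' := 0) (b' := m) le_rfl (by omega)
  have ly1 := ho_mono Y (a := 0) (b := 128 * P) (a' := 0) (b' := n) le_rfl (by omega)
  have lx2 := ho_mono X (a := m - 128 * P) (b := m - 0) (a' := 0) (b' := m) (by omega) (by omega)
  have ly2 := ho_mono Y (a := n - 128 * P) (b := n - 0) (a' := 0) (b' := n) (by omega) (by omega)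
  obtain ⟨X1, hX1, Y1, hY1, a1, b1, m1⟩ := hC1 J σ P X Y m n hσ hP hm hn hmL hnL hX hY
  obtain ⟨X2, hX2, Y2, hY2, a2, b2, m2⟩ := hC2 J σ P X Y hσ hP (by omega) (by omega)
  obtain ⟨X3, hX3, Y3, hY3, a3, b3, m3⟩ := hC2 J σ P (X.image (fun x => m - 1 - x)) (Y.image (fun x => n - 1 - x)) hσ hP
    (by rw [ho_reflect]; omega) (by rw [ho_reflect]; omega)
  simp only [ho_reflect] at m3
  obtain ⟨X4, hX4⟩ : ∃ X4, X4 = X3.image (fun x => m - 1 - x) := ⟨_, rfl⟩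
  obtain ⟨Y4, hY4⟩ : ∃ Y4, Y4 = Y3.image (fun x => n - 1 - x) := ⟨_, rfl⟩
  have a4 : X4.card ≤ X3.card := by rw [hX4]; exact Finset.card_image_le
  have b4 : Y4.card ≤ Y3.card := by rw [hY4]; exact Finset.card_image_le
  have hX4s : X4 ⊆ X := by
    intro x hx
    rw [hX4] at hx
    obtain ⟨y, hy, rfl⟩ := Finset.mem_image.1 hx
    obtain ⟨z, hz, rfl⟩ := Finset.mem_image.1 (hX3 hy)
    simpa using hz
  have hY4s : Y4 ⊆ Y := by
    intro x hx
    rw [hY4] at hx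
    obtain ⟨y, hy, rfl⟩ := Finset.mem_image.1 hx
    obtain ⟨z, hz, rfl⟩ := Finset.mem_image.1 (hY3 hy)
    simpa using hz
  have m4 : (Finset.Ico (m + n - 1 - 64 * P) (m + n - 1) \ (X4 + Y4)).card ≤
      (Finset.Ico 0 (64 * P : ℤ) \ (X3 + Y3)).card := by
    apply Finset.card_le_card_of_injOn (fun z => m + n - 2 - z)
    · intro z hz
      simp only [Finset.coe_sdiff, Set.mem_sdiff, Finset.mem_coe, Finset.mem_Ico] at hz ⊢
      refine ⟨⟨by omega, by omega⟩, fun hh => hz.2 ?_⟩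
      obtain ⟨x, hx, y, hy, he⟩ := Finset.mem_add.1 hh
      have : z = (m - 1 - x) + (n - 1 - y) := by omega
      rw [this, hX4, hY4]
      exact Finset.add_mem_add (Finset.mem_image_of_mem (fun x => m - 1 - x) hx)
        (Finset.mem_image_of_mem (fun x => n - 1 - x) hy)
    · intro x _ y _ hxy
      simp only at hxy
      omega
  refine ⟨X1 ∪ X2 ∪ X4, Finset.union_subset (Finset.union_subset hX1 hX2) hX4s,
    Y1 ∪ Y2 ∪ Y4, Finset.union_subset (Finset.union_subset hY1 hY2) hY4s, ?_, ?_, ?_⟩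
  · have u1 := Finset.card_union_le (X1 ∪ X2) X4
    have u2 := Finset.card_union_le X1 X2
    clear * - u1 u2 a1 a2 a3 a4
    nlinarith
  · have u1 := Finset.card_union_le (Y1 ∪ Y2) Y4
    have u2 := Finset.card_union_le Y1 Y2
    clear * - u1 u2 b1 b2 b3 b4
    nlinarith
  · have hsub : Finset.Ico 0 (m + n - 1) \ (X1 ∪ X2 ∪ X4 + (Y1 ∪ Y2 ∪ Y4)) ⊆
        (Finset.Ico (32 * P : ℤ) (m + n - 48 * P) \ (X1 + Y1)) ∪ (Finset.Ico 0 (64 * P : ℤ) \ (X2 + Y2)) ∪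
        (Finset.Ico (m + n - 1 - 64 * P) (m + n - 1) \ (X4 + Y4)) := by
      intro z hz
      have hz1 := Finset.mem_sdiff.1 (sdiff_union_add _ (X1 ∪ X2) X4 (Y1 ∪ Y2) Y4 hz)
      have hz2 := Finset.mem_sdiff.1 (sdiff_union_add _ X1 X2 Y1 Y2 hz1.1)
      have hz3 := Finset.mem_sdiff.1 hz2.1
      have hz4 := Finset.mem_Ico.1 hz3.1
      simp only [Finset.mem_union, Finset.mem_sdiff, Finset.mem_Ico]
      by_cases h1 : z < 64 * P
      · left; right; exact ⟨⟨hz4.1, h1⟩, hz2.2⟩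
      · by_cases h2 : z < m + n - 48 * P
        · left; left; exact ⟨⟨by omega, h2⟩, hz3.2⟩
        · right; exact ⟨⟨by omega, hz4.2⟩, hz1.2⟩
    have s1 := Finset.card_le_card hsub
    have s2 := Finset.card_union_le ((Finset.Ico (32 * P : ℤ) (m + n - 48 * P) \ (X1 + Y1)) ∪ (Finset.Ico 0 (64 * P : ℤ) \ (X2 + Y2)))
        (Finset.Ico (m + n - 1 - 64 * P) (m + n - 1) \ (X4 + Y4))
    have s3 := Finset.card_union_le (Finset.Ico (32 * P : ℤ) (m + n - 48 * P) \ (X1 + Y1)) (Finset.Ico 0 (64 * P : ℤ) \ (X2 + Y2))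
    have e0 : m - 0 = m := by ring
    have e1 : n - 0 = n := by ring
    rw [e0, e1] at m3
    have x1 := ho_add X (a := 0) (b := 8 * P) (c := m) (by omega) (by omega)
    have x2 := ho_add X (a := 8 * P) (b := m - 8 * P) (c := m) (by omega) (by omega)
    have x3 := ho_mono X (a := 8 * P) (b := 128 * P) (a' := 8 * P) (b' := m - 8 * P) (by omega) (by omega)
    have x4 := ho_mono X (a := m - 128 * P) (b := m - 8 * P) (a' := 8 * P) (b' := m - 8 * P) (by omega) (by omega)
    have y1 := ho_add Y (a := 0) (b := 8 * P) (c := n) (by omega) (by omega)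
    have y2 := ho_add Y (a := 8 * P) (b := n - 8 * P) (c := n) (by omega) (by omega)
    have y3 := ho_mono Y (a := 8 * P) (b := 128 * P) (a' := 8 * P) (b' := n - 8 * P) (by omega) (by omega)
    have y4 := ho_mono Y (a := n - 128 * P) (b := n - 8 * P) (a' := 8 * P) (b' := n - 8 * P) (by omega) (by omega)
    clear * - m1 m2 m3 m4 s1 s2 s3 x1 x2 x3 x4 y1 y2 y3 y4
    omega

lemma choose_J (C c2 n0 : ℕ) (h1 : 4 * C ≤ c2) (h2 : 1 ≤ n0) :
    ∃ J : ℕ, 4 * C * 2 ^ J ≤ c2 ∧ 4 ^ J ≤ n0 ∧ (c2 < 4 * C * 2 ^ (J + 1) ∨ n0 < 4 ^ (J + 1)) := by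
  by_contra hcon
  push Not at hcon
  have : ∀ J : ℕ, 4 * C * 2 ^ J ≤ c2 ∧ 4 ^ J ≤ n0 := by
    intro J
    induction J with
    | zero => simpa using ⟨h1, h2⟩
    | succ J ih => exact hcon J ih.1 ih.2
  have h3 := (this n0).2
  have h4 : n0 < 4 ^ n0 := Nat.lt_pow_self (by norm_num)
  omega

set_option maxHeartbeats 1000000 in
lemma half_thm (R : ℕ) : ∃ c : ℕ, 0 < c ∧ ∀ (X Y : Finset ℤ) (m n c1 c2 : ℕ), X ⊆ Finset.Ico 0 (m : ℤ) → Y ⊆ Finset.Ico 0 (n : ℤ) →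
    m ≤ R * n → n ≤ R * m → 1 ≤ R → 1 ≤ c1 → c1 ≤ X.card → 1 ≤ c2 → c2 ≤ Y.card → c2 ≤ c1 →
    c * X.card ≤ c1 * c2 →
    10000000 * ho X 0 m ≤ min m n → 10000000 * ho Y 0 n ≤ min m n →
    ∃ X' ⊆ X, ∃ Y' ⊆ Y, X'.card = c1 ∧ Y'.card = c2 ∧ X.card + Y.card ≤ (X' + Y').card + 1 := by
  obtain ⟨C0, hC0⟩ := int_thm (512 * R)
  obtain ⟨C, hCe⟩ : ∃ C, C = C0 + 1 := ⟨_, rfl⟩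
  refine ⟨8 * (C * C) + 4 * C + 256, by omega, ?_⟩
  intro X Y m n c1 c2 hX hY hmn hnm hR h11 h1X h21 h2Y h21' hc hhX hhY
  have hcc2 : 8 * (C * C) + 4 * C + 256 ≤ c2 := by
    have h1 : (8 * (C * C) + 4 * C + 256) * c1 ≤ c2 * c1 :=
      (Nat.mul_le_mul_left _ h1X).trans (hc.trans (le_of_eq (mul_comm _ _)))
    exact Nat.le_of_mul_le_mul_right h1 h11
  have cX := ho_card X (a := 0) (b := m) (by omega)
  have cY := ho_card Y (a := 0) (b := n) (by omega)
  rw [Finset.inter_eq_left.2 hX] at cX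
  rw [Finset.inter_eq_left.2 hY] at cY
  obtain ⟨μ, hμ⟩ : ∃ μ, μ = min m n := ⟨_, rfl⟩
  rw [← hμ] at hhX hhY
  have hμm : μ ≤ m := by rw [hμ]; exact min_le_left _ _
  have hμn : μ ≤ n := by rw [hμ]; exact min_le_right _ _
  have hμc : 256 ≤ μ := by omega
  have hmμ : m ≤ R * μ := by
    rcases le_total m n with h | h
    · rw [hμ, min_eq_left h]; nlinarith
    · rw [hμ, min_eq_right h]; exact hmn
  have hnμ : n ≤ R * μ := by
    rcases le_total m n with h | h
    · rw [hμ, min_eq_left h]; exact hnm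
    · rw [hμ, min_eq_right h]; nlinarith
  obtain ⟨J, hJ1, hJ2, hJ3⟩ := choose_J C c2 (μ / 256) (by omega) (by omega)
  obtain ⟨n0, hn0⟩ : ∃ n0, n0 = μ / 256 := ⟨_, rfl⟩
  rw [← hn0] at hJ2 hJ3
  obtain ⟨q, hq⟩ : ∃ q, q = 4 ^ J := ⟨_, rfl⟩
  obtain ⟨s, hs⟩ : ∃ s, s = 2 ^ J := ⟨_, rfl⟩
  have hss : q = s * s := by rw [hq, hs, show (4 : ℕ) = 2 * 2 from rfl, mul_pow]
  have hs0 : 0 < s := by rw [hs]; positivity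
  have hq0 : 0 < q := by rw [hq]; positivity
  obtain ⟨σ, hσ⟩ : ∃ σ, σ = n0 / q := ⟨_, rfl⟩
  rw [← hq] at hJ2
  have hσ0 : 0 < σ := by rw [hσ]; exact Nat.div_pos hJ2 hq0
  obtain ⟨P, hP⟩ : ∃ P, P = σ * q := ⟨_, rfl⟩
  have hPn : P ≤ n0 := by rw [hP, hσ]; exact Nat.div_mul_le_self _ _
  have hPn2 : n0 < 2 * P := by
    have h1 : n0 < q * (σ + 1) := by rw [hσ]; exact Nat.lt_mul_div_succ _ hq0
    have h2 : q * 1 ≤ q * σ := Nat.mul_le_mul_left _ hσ0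
    have h3 : P = q * σ := by rw [hP]; ring
    rw [mul_add] at h1
    omega
  have hμP : μ ≤ 512 * P := by omega
  obtain ⟨X1, hX1, Y1, hY1, k1, k2, hmiss⟩ := hC0 J σ P X Y m n hσ0 (by rw [hP, hq]) (by omega) (by omega)
    (by
      have : m ≤ 512 * R * P :=
        hmμ.trans ((Nat.mul_le_mul_left R hμP).trans (le_of_eq (by ring)))
      exact_mod_cast this) (by
      have : n ≤ 512 * R * P :=
        hnμ.trans ((Nat.mul_le_mul_left R hμP).trans (le_of_eq (by ring)))
      exact_mod_cast this) (by omega) (by omega)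
  rw [← hs] at k1 k2 hJ1
  have hk2 : Y1.card ≤ c2 := by
    have : C0 * s ≤ C * s := Nat.mul_le_mul_right _ (by omega)
    have e : 4 * C * s = 4 * (C * s) := by ring
    omega
  have hk1 : X1.card ≤ c1 := by
    have h1 : C0 * (σ * s) ≤ C * (σ * s) := Nat.mul_le_mul_right _ (by omega)
    refine (k1.trans h1).trans ?_
    rcases hJ3 with h | h
    · have e : 4 * C * 2 ^ (J + 1) = 8 * C * s := by rw [hs]; ring
      rw [e] at h
      have g1 : n0 ≤ X.card := by omega
      have g2 : 8 * (C * C) * n0 ≤ c1 * c2 := by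
        refine le_trans ?_ hc
        exact Nat.mul_le_mul (by omega) g1
      have g3 : c1 * c2 ≤ c1 * (8 * C * s) := Nat.mul_le_mul_left _ h.le
      have g4 : (8 * C) * (C * n0) ≤ (8 * C) * (c1 * s) := by
        have := g2.trans g3
        nlinarith
      have g5 : C * n0 ≤ c1 * s := Nat.le_of_mul_le_mul_left g4 (by omega)
      have g6 : C * (σ * s) * s ≤ c1 * s := by
        refine le_trans ?_ g5
        have : C * (σ * s) * s = C * P := by rw [hP, hss]; ring
        rw [this]
        exact Nat.mul_le_mul_left _ hPn
      exact Nat.le_of_mul_le_mul_right g6 hs0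
    · have e : 4 ^ (J + 1) = 4 * q := by rw [hq]; ring
      rw [e] at h
      have g : σ < 4 := by
        rw [hσ]
        exact (Nat.div_lt_iff_lt_mul hq0).2 h
      have : C * (σ * s) ≤ 4 * C * s := by
        have : σ * (C * s) ≤ 4 * (C * s) := Nat.mul_le_mul_right _ g.le
        nlinarith
      omega
  obtain ⟨X', hX1', hX', cX'⟩ := Finset.exists_subsuperset_card_eq hX1 hk1 h1X
  obtain ⟨Y', hY1', hY', cY'⟩ := Finset.exists_subsuperset_card_eq hY1 hk2 h2Y
  refine ⟨X', hX', Y', hY', cX', cY', ?_⟩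
  have f1 := sdiff_anti (Finset.Ico 0 ((m : ℤ) + n - 1)) X1 X' Y1 Y' hX1' hY1'
  have f2 := Finset.card_inter_add_card_sdiff (Finset.Ico 0 ((m : ℤ) + n - 1)) (X' + Y')
  have f3 := Finset.card_le_card (Finset.inter_subset_right (s₁ := Finset.Ico 0 ((m : ℤ) + n - 1)) (s₂ := X' + Y'))
  rw [Int.card_Ico] at f2
  omega

lemma full_thm (R : ℕ) : ∃ c : ℕ, 0 < c ∧ ∀ (X Y : Finset ℤ) (m n c1 c2 : ℕ), X ⊆ Finset.Ico 0 (m : ℤ) → Y ⊆ Finset.Ico 0 (n : ℤ) →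
    m ≤ R * n → n ≤ R * m → 1 ≤ R → 1 ≤ c1 → c1 ≤ X.card → 1 ≤ c2 → c2 ≤ Y.card →
    c * max X.card Y.card ≤ c1 * c2 →
    10000000 * ho X 0 m ≤ min m n → 10000000 * ho Y 0 n ≤ min m n →
    ∃ X' ⊆ X, ∃ Y' ⊆ Y, X'.card = c1 ∧ Y'.card = c2 ∧ X.card + Y.card ≤ (X' + Y').card + 1 := by
  obtain ⟨c, hc0, hc⟩ := half_thm R
  refine ⟨c, hc0, ?_⟩
  intro X Y m n c1 c2 hX hY hmn hnm hR h11 h1X h21 h2Y hcc hhX hhY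
  rcases le_total c2 c1 with h | h
  · exact hc X Y m n c1 c2 hX hY hmn hnm hR h11 h1X h21 h2Y h
      ((Nat.mul_le_mul_left _ (le_max_left _ _)).trans hcc) hhX hhY
  · obtain ⟨Y', hY', X', hX', d1, d2, d3⟩ := hc Y X n m c2 c1 hY hX hnm hmn hR h21 h2Y h11 h1X h
      ((Nat.mul_le_mul_left _ (le_max_right _ _)).trans (by rw [mul_comm c2 c1]; exact hcc))
      (by rw [min_comm]; exact hhY) (by rw [min_comm]; exact hhX)
    refine ⟨X', hX', Y', hY', d2, d1, ?_⟩
    rw [add_comm X' Y']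
    omega

lemma img_card (p : ℕ) (a : ZMod p) (S : Finset ℤ) (q : ℤ) (hq : q ≤ p) (hS : S ⊆ Finset.Ico 0 q) :
    (S.image (fun i : ℤ => a + (i : ZMod p))).card = S.card := by
  apply Finset.card_image_of_injOn
  intro x hx y hy h
  have hx' := Finset.mem_Ico.1 (hS hx)
  have hy' := Finset.mem_Ico.1 (hS hy)
  have h1 : (x : ZMod p) = (y : ZMod p) := add_left_cancel h
  rw [ZMod.intCast_eq_intCast_iff] at h1
  have h2 : x % p = y % p := h1
  rwa [Int.emod_eq_of_lt hx'.1 (by omega), Int.emod_eq_of_lt hy'.1 (by omega)] at h2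

lemma zmodInterval_eq (p : ℕ) (a : ZMod p) (n : ℕ) :
    zmodInterval p a n = (Finset.Ico 0 (n : ℤ)).image (fun i : ℤ => a + (i : ZMod p)) := by
  ext x
  simp only [zmodInterval, Finset.mem_image, Finset.mem_range, Finset.mem_Ico]
  constructor
  · rintro ⟨i, hi, rfl⟩
    exact ⟨i, by omega, by simp⟩
  · rintro ⟨i, hi, rfl⟩
    refine ⟨i.toNat, by omega, ?_⟩
    have : ((i.toNat : ℤ) : ZMod p) = (i : ZMod p) := by rw [Int.toNat_of_nonneg hi.1]
    rw [← this, Int.cast_natCast]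

lemma zmodInterval_card (p : ℕ) (a : ZMod p) (n : ℕ) (hn : n ≤ p) : (zmodInterval p a n).card = n := by
  rw [zmodInterval_eq, img_card p a _ n (by omega) (Finset.Subset.refl _), Int.card_Ico]
  omega

lemma zmodInterval_big (p : ℕ) (a : ZMod p) (n : ℕ) (hn : p ≤ n) : p ≤ (zmodInterval p a n).card := by
  refine (zmodInterval_card p a p le_rfl).symm.le.trans ?_
  apply Finset.card_le_card
  apply Finset.image_subset_image
  intro i hi
  simp only [Finset.mem_range] at *
  omega

lemma lift_set (p : ℕ) (a : ZMod p) (n : ℕ) (hn : n ≤ p) (X : Finset (ZMod p)) (hX : X ⊆ zmodInterval p a n) :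
    ∃ S : Finset ℤ, S ⊆ Finset.Ico 0 (n : ℤ) ∧ S.image (fun i : ℤ => a + (i : ZMod p)) = X ∧ S.card = X.card ∧
      ho S 0 n = (zmodInterval p a n \ X).card := by
  classical
  have hsub : (Finset.Ico 0 (n : ℤ)).filter (fun i : ℤ => a + (i : ZMod p) ∈ X) ⊆ Finset.Ico 0 (n : ℤ) :=
    Finset.filter_subset _ _
  have him : ((Finset.Ico 0 (n : ℤ)).filter (fun i : ℤ => a + (i : ZMod p) ∈ X)).image
      (fun i : ℤ => a + (i : ZMod p)) = X := by
    ext x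
    simp only [Finset.mem_image, Finset.mem_filter]
    constructor
    · rintro ⟨i, hi, rfl⟩
      exact hi.2
    · intro hx
      have h1 := hX hx
      rw [zmodInterval_eq] at h1
      obtain ⟨i, hi, rfl⟩ := Finset.mem_image.1 h1
      exact ⟨i, ⟨hi, hx⟩, rfl⟩
  have hc := img_card p a _ n (by omega) hsub
  rw [him] at hc
  refine ⟨_, hsub, him, hc.symm, ?_⟩
  have h1 := ho_card ((Finset.Ico 0 (n : ℤ)).filter (fun i : ℤ => a + (i : ZMod p) ∈ X)) (a := 0) (b := n) (by omega)
  rw [Finset.inter_eq_left.2 hsub] at h1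
  have h2 := Finset.card_sdiff_add_card_eq_card hX
  rw [zmodInterval_card p a n hn] at h2
  omega

theorem stmt6 :
    ∃ γ : ℝ, 0 < γ ∧
      ∀ α : ℝ, 0 < α →
        ∃ c : ℝ, 0 < c ∧
          ∀ (p : ℕ), p.Prime →
            ∀ (aI aJ : ZMod p) (nI nJ : ℕ) (X Y : Finset (ZMod p)),
              X ⊆ zmodInterval p aI nI → Y ⊆ zmodInterval p aJ nJ →
              ∀ c₁ c₂ : ℕ, 1 ≤ c₁ → c₁ ≤ X.card → 1 ≤ c₂ → c₂ ≤ Y.card →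
                c * (max X.card Y.card : ℕ) ≤ (c₁ * c₂ : ℝ) →
                α * (zmodInterval p aJ nJ).card ≤ ((zmodInterval p aI nI).card : ℝ) →
                ((zmodInterval p aI nI).card : ℝ) ≤ α⁻¹ * (zmodInterval p aJ nJ).card →
                (zmodInterval p aI nI).card + (zmodInterval p aJ nJ).card ≤ p →
                ((max ((zmodInterval p aI nI \ X).card) ((zmodInterval p aJ nJ \ Y).card) : ℕ) : ℝ) ≤
                  γ * (min (zmodInterval p aI nI).card (zmodInterval p aJ nJ).card : ℕ) →
                ∃ X' ⊆ X, ∃ Y' ⊆ Y, X'.card = c₁ ∧ Y'.card = c₂ ∧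
                  (X.card : ℤ) + Y.card - 1 ≤ ((X' + Y').card : ℤ) := by
  refine ⟨1 / 10000000, by norm_num, ?_⟩
  intro α hα
  obtain ⟨R0, hR0⟩ := exists_nat_ge α⁻¹
  obtain ⟨c, hc0, hc⟩ := full_thm (R0 + 1)
  refine ⟨c, by exact_mod_cast hc0, ?_⟩
  intro p hp aI aJ nI nJ X Y hX hY c₁ c₂ h11 h1X h21 h2Y hcc hα1 hα2 hsum hmax
  have hXI := Finset.card_le_card hX
  have hYJ := Finset.card_le_card hY
  have hIp : nI ≤ p := by
    by_contra hcon
    have := zmodInterval_big p aI nI (by omega)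
    omega
  have hJp : nJ ≤ p := by
    by_contra hcon
    have := zmodInterval_big p aJ nJ (by omega)
    omega
  obtain ⟨S, hS1, hS2, hS3, hS4⟩ := lift_set p aI nI hIp X hX
  obtain ⟨T, hT1, hT2, hT3, hT4⟩ := lift_set p aJ nJ hJp Y hY
  rw [← hS4, ← hT4] at hmax
  rw [zmodInterval_card p aI nI hIp, zmodInterval_card p aJ nJ hJp] at *
  have hmax' : 10000000 * max (ho S 0 nI) (ho T 0 nJ) ≤ min nI nJ := by
    have : (10000000 : ℝ) * (max (ho S 0 nI) (ho T 0 nJ) : ℕ) ≤ (min nI nJ : ℕ) := by linarith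
    exact_mod_cast this
  have hR1 : nI ≤ (R0 + 1) * nJ := by
    have : (nI : ℝ) ≤ (R0 + 1) * nJ :=
      hα2.trans (mul_le_mul_of_nonneg_right (by linarith) (by positivity))
    exact_mod_cast this
  have hR2 : nJ ≤ (R0 + 1) * nI := by
    have h1 : (nJ : ℝ) ≤ α⁻¹ * nI := by
      rw [inv_mul_eq_div, le_div_iff₀ hα]
      linarith
    have : (nJ : ℝ) ≤ (R0 + 1) * nI :=
      h1.trans (mul_le_mul_of_nonneg_right (by linarith) (by positivity))
    exact_mod_cast this
  obtain ⟨S', hS', T', hT', d1, d2, d3⟩ := hc S T nI nJ c₁ c₂ hS1 hT1 hR1 hR2 (by omega) h11 (by omega) h21 (by omega)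
    (by rw [hS3, hT3]; exact_mod_cast hcc) (by omega) (by omega)
  refine ⟨S'.image (fun i : ℤ => aI + (i : ZMod p)), ?_, T'.image (fun i : ℤ => aJ + (i : ZMod p)), ?_, ?_, ?_, ?_⟩
  · rw [← hS2]; exact Finset.image_subset_image hS'
  · rw [← hT2]; exact Finset.image_subset_image hT'
  · rw [img_card p aI S' nI (by omega) (hS'.trans hS1), d1]
  · rw [img_card p aJ T' nJ (by omega) (hT'.trans hT1), d2]
  · have e1 := img_card p (aI + aJ) (S' + T') ((nI : ℤ) + nJ) (by omega) (by
      intro z hz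
      obtain ⟨x, hx, y, hy, rfl⟩ := Finset.mem_add.1 hz
      have hx' := Finset.mem_Ico.1 (hS1 (hS' hx))
      have hy' := Finset.mem_Ico.1 (hT1 (hT' hy))
      rw [Finset.mem_Ico]
      omega)
    have e2 : (S' + T').image (fun i : ℤ => aI + aJ + (i : ZMod p)) ⊆
        S'.image (fun i : ℤ => aI + (i : ZMod p)) + T'.image (fun i : ℤ => aJ + (i : ZMod p)) := by
      intro z hz
      obtain ⟨w, hw, rfl⟩ := Finset.mem_image.1 hz
      obtain ⟨x, hx, y, hy, rfl⟩ := Finset.mem_add.1 hw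
      have : aI + aJ + ((x + y : ℤ) : ZMod p) = (aI + (x : ZMod p)) + (aJ + (y : ZMod p)) := by
        push_cast; ring
      rw [this]
      exact Finset.add_mem_add (Finset.mem_image_of_mem (fun i : ℤ => aI + (i : ZMod p)) hx)
        (Finset.mem_image_of_mem (fun i : ℤ => aJ + (i : ZMod p)) hy)
    have e3 := Finset.card_le_card e2
    omega
end
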